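/- arXiv:2312.01803 — 2 statements merged into one kernel-verified Lean document; each statement's English description precedes it below -/
import Mathlib

section
/- For every θ ≥ 2, every c_0 > 0 and every choice of constants in the Harnack assumptions there exists C_1 > 0 such that: for every Markov kernel (Γ,K,π) that is lazy and satisfies the Harnack assumptions with parameter θ and those constants, and all x,y ∈ V with d(x,y) ≥ c_0·D, the normalized Green function satisfies |𝒢(x,y)| ≤ C_1·D^θ. -/
open Finset
open scoped Classical

variable {V : Type*} [Fintype V] [DecidableEq V]

/-- `matpow K n` is the `n`-th matrix power of the kernel `K`. -/
noncomputable def matpow (K : V → V → ℝ) : ℕ → V → V → ℝ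
  | 0 => fun x y => if x = y then (1 : ℝ) else 0
  | n + 1 => fun x y => ∑ z, K x z * matpow K n z y

/-- `(Γ, K, π)` is a Markov kernel: `G` is a connected (simple) graph on the finite vertex
set `V`, `K` is a stochastic kernel, irreducible, reversible with respect to the probability
measure `pi`, positive on edges and vanishing off edges (apart from the diagonal). -/
def IsMarkovKernel (G : SimpleGraph V) (K : V → V → ℝ) (pi : V → ℝ) : Prop :=
  G.Connected ∧
  (∀ x y, 0 ≤ K x y) ∧ (∀ x, ∑ y, K x y = 1) ∧
  (∀ x, 0 < pi x) ∧ (∑ x, pi x = 1) ∧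
  (∀ x y, pi x * K x y = pi y * K y x) ∧
  (∀ x y, G.Adj x y → 0 < K x y) ∧
  (∀ x y, x ≠ y → ¬ G.Adj x y → K x y = 0) ∧
  (∀ x y, ∃ n, 0 < matpow K n x y)

/-- Aperiodicity of an irreducible finite kernel, via primitivity. -/
def Aperiodic (K : V → V → ℝ) : Prop :=
  ∃ N : ℕ, ∀ n ≥ N, ∀ x y, 0 < matpow K n x y

/-- `K` is lazy if `K(x,x) ≥ 1/2` for all `x`. -/
def Lazy (K : V → V → ℝ) : Prop := ∀ x, (1 : ℝ) / 2 ≤ K x x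

/-- The closed ball `B(x,r)` for the graph distance. -/
noncomputable def gball (G : SimpleGraph V) (x : V) (r : ℝ) : Finset V :=
  univ.filter fun y => (G.dist x y : ℝ) ≤ r

/-- The volume `V(x,r) = π(B(x,r))`. -/
noncomputable def vol (G : SimpleGraph V) (pi : V → ℝ) (x : V) (r : ℝ) : ℝ :=
  ∑ y ∈ gball G x r, pi y

/-- The diameter of the graph `G`. -/
noncomputable def gdiam (G : SimpleGraph V) : ℕ :=
  univ.sup fun x => univ.sup fun y => G.dist x y

/-- The normalized kernel `k^n(x,y) = K^n(x,y)/π(y)`. -/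
noncomputable def knorm (K : V → V → ℝ) (pi : V → ℝ) (n : ℕ) (x y : V) : ℝ :=
  matpow K n x y / pi y

/-- The normalized Green function `𝒢(x,y) = ∑_{n≥0} (k^n(x,y) - 1)`. -/
noncomputable def green (K : V → V → ℝ) (pi : V → ℝ) (x y : V) : ℝ :=
  ∑' n : ℕ, (knorm K pi n x y - 1)

/-- `avoid K y n x = P_x(X_0 ≠ y, …, X_n ≠ y) = P_x(τ_y > n)`. -/
noncomputable def avoid (K : V → V → ℝ) (y : V) : ℕ → V → ℝ
  | 0 => fun x => if x = y then 0 else 1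
  | n + 1 => fun x => if x = y then 0 else ∑ z, K x z * avoid K y n z

/-- The expected hitting time `H(x,y) = E_x[τ_y] = ∑_{n≥0} P_x(τ_y > n)`. -/
noncomputable def hit (K : V → V → ℝ) (x y : V) : ℝ := ∑' n : ℕ, avoid K y n x

/-- `P_x(d(x, X_s) > R)` for the chain driven by `K` started at `x`. -/
noncomputable def probGt (G : SimpleGraph V) (K : V → V → ℝ) (x : V) (s : ℕ) (R : ℝ) : ℝ :=
  ∑ y ∈ univ.filter (fun y => R < (G.dist x y : ℝ)), matpow K s x y

/-- The probability that the chain driven by `K`, started at `x`, produces a trajectory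
`(X_0, …, X_t)` belonging to the event `A`. -/
noncomputable def pathProb (K : V → V → ℝ) (x : V) (t : ℕ)
    (A : (Fin (t + 1) → V) → Prop) : ℝ :=
  ∑ p ∈ univ.filter (fun p : Fin (t + 1) → V => p 0 = x ∧ A p),
    ∏ i : Fin t, K (p i.castSucc) (p i.succ)

/-- Condition (E): ellipticity with constant `p0`. -/
def CondE (G : SimpleGraph V) (K : V → V → ℝ) (p0 : ℝ) : Prop :=
  ∀ x y, G.Adj x y → p0 ≤ K x y

/-- Condition (VD): volume doubling with constant `CD`. -/
def CondVD (G : SimpleGraph V) (pi : V → ℝ) (CD : ℝ) : Prop :=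
  ∀ x : V, ∀ r : ℝ, 0 < r → vol G pi x (2 * r) ≤ CD * vol G pi x r

/-- The `π`-average of `f` over the ball `B(x,r)`. -/
noncomputable def ballAvg (G : SimpleGraph V) (pi : V → ℝ) (x : V) (r : ℝ) (f : V → ℝ) : ℝ :=
  (vol G pi x r)⁻¹ * ∑ z ∈ gball G x r, f z * pi z

/-- Condition (PI(θ)): Poincaré inequality with constant `CP`. -/
def CondPI (G : SimpleGraph V) (K : V → V → ℝ) (pi : V → ℝ) (θ CP : ℝ) : Prop :=
  ∀ x : V, ∀ r : ℝ, 0 < r → ∀ f : V → ℝ,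
    (∑ z ∈ gball G x r, |f z - ballAvg G pi x r f| ^ 2 * pi z) ≤
      CP * r ^ θ * ∑ ξ ∈ gball G x r, ∑ ζ ∈ gball G x r,
        if G.Adj ξ ζ then |f ξ - f ζ| ^ 2 * K ξ ζ * pi ξ else 0

/-- Condition (CS(θ)): existence of cut-off functions. -/
def CondCS (G : SimpleGraph V) (K : V → V → ℝ) (pi : V → ℝ) (θ C1 C2 ε : ℝ) : Prop :=
  ∀ x : V, ∀ r : ℝ, 0 < r → ∃ σ : V → ℝ,
    (∀ y ∈ gball G x (r / 2), 1 ≤ σ y) ∧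
    (∀ y, y ∉ gball G x r → σ y = 0) ∧
    (∀ z y, |σ z - σ y| ≤ C1 * ((G.dist z y : ℝ) / r) ^ ε) ∧
    (∀ s : ℝ, 0 < s → s ≤ r → ∀ f : V → ℝ,
      (∑ z ∈ gball G x s, |f z| ^ 2 *
          ∑ y, (if G.Adj z y then |σ z - σ y| ^ 2 * K z y * pi z else 0)) ≤
        C2 * (s / r) ^ (2 * ε) *
          ((∑ z ∈ gball G x (2 * s), ∑ y ∈ gball G x (2 * s),
              if G.Adj z y then |f z - f y| ^ 2 * K z y * pi z else 0) +
            s ^ (-θ) * ∑ z ∈ gball G x (2 * s), |f z| ^ 2 * pi z))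

/-- The Harnack assumptions (E), (VD), (PI(θ)), (CS(θ)) with the given constants. -/
def Harnack (G : SimpleGraph V) (K : V → V → ℝ) (pi : V → ℝ)
    (θ p0 CD CP Ccs1 Ccs2 ε : ℝ) : Prop :=
  0 < p0 ∧ 0 < CD ∧ 0 < CP ∧ 0 < Ccs1 ∧ 0 < Ccs2 ∧ 0 < ε ∧
  CondE G K p0 ∧ CondVD G pi CD ∧ CondPI G K pi θ CP ∧ CondCS G K pi θ Ccs1 Ccs2 ε


set_option linter.unusedSectionVars false
set_option linter.unusedVariables false

/-- edge conductance -/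
noncomputable def JJ (K : V → V → ℝ) (pi : V → ℝ) (z w : V) : ℝ := pi z * K z w

/-- energy of `f` on `A` -/
noncomputable def en (K : V → V → ℝ) (pi : V → ℝ) (f : V → ℝ) (A : Finset V) : ℝ :=
  ∑ z ∈ A, ∑ w ∈ A, (f z - f w) ^ 2 * JJ K pi z w

/-- squared mass of `f` on `A` -/
noncomputable def mass (pi : V → ℝ) (f : V → ℝ) (A : Finset V) : ℝ :=
  ∑ z ∈ A, f z ^ 2 * pi z

/-- the working hypotheses -/
structure Sett (G : SimpleGraph V) (K : V → V → ℝ) (pi : V → ℝ)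
    (θ CD CP Cc : ℝ) (m : ℕ) : Prop where
  conn : G.Connected
  knn : ∀ x y, 0 ≤ K x y
  ksum : ∀ x, ∑ y, K x y = 1
  pipos : ∀ x, 0 < pi x
  pisum : ∑ x, pi x = 1
  rev : ∀ x y, pi x * K x y = pi y * K y x
  step : ∀ x y, K x y ≠ 0 → (G.dist x y : ℝ) ≤ 1
  lazy : ∀ x, (1 : ℝ) / 2 ≤ K x x
  hθ : 2 ≤ θ
  hCD : 1 ≤ CD
  hCP : 0 < CP
  hCc : 0 < Cc
  hm : 1 ≤ m
  hCDm : CD ≤ 2 ^ m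
  vd : ∀ x : V, ∀ r : ℝ, 0 < r → vol G pi x (2 * r) ≤ CD * vol G pi x r
  pI : ∀ x : V, ∀ r : ℝ, 0 < r → ∀ f : V → ℝ,
    mass pi f (gball G x r) ≤ CP * r ^ θ * en K pi f (gball G x r) +
      (∑ z ∈ gball G x r, f z * pi z) ^ 2 / vol G pi x r
  cs : ∀ x : V, ∀ r : ℝ, 1 ≤ r → ∃ σ : V → ℝ,
    (∀ z, 0 ≤ σ z) ∧ (∀ z, σ z ≤ 1) ∧
    (∀ z, (G.dist x z : ℝ) ≤ r / 2 → σ z = 1) ∧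
    (∀ z, r < (G.dist x z : ℝ) → σ z = 0) ∧
    (∀ f : V → ℝ, ∑ z, ∑ w, f z ^ 2 * (σ z - σ w) ^ 2 * JJ K pi z w ≤
      Cc * (en K pi f (gball G x (2 * r)) + r ^ (-θ) * mass pi f (gball G x (2 * r))))

lemma mem_gball (G : SimpleGraph V) (x y : V) (r : ℝ) :
    y ∈ gball G x r ↔ (G.dist x y : ℝ) ≤ r := by
  simp [gball]

lemma en_mono {K : V → V → ℝ} {pi : V → ℝ} (hJ : ∀ z w, 0 ≤ JJ K pi z w) (f : V → ℝ)
    {A B : Finset V} (h : A ⊆ B) : en K pi f A ≤ en K pi f B := by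
  unfold en
  calc ∑ z ∈ A, ∑ w ∈ A, (f z - f w) ^ 2 * JJ K pi z w
      ≤ ∑ z ∈ A, ∑ w ∈ B, (f z - f w) ^ 2 * JJ K pi z w := by
        refine Finset.sum_le_sum fun z _ => Finset.sum_le_sum_of_subset_of_nonneg h ?_
        intro w _ _
        exact mul_nonneg (sq_nonneg _) (hJ _ _)
    _ ≤ _ := by
        refine Finset.sum_le_sum_of_subset_of_nonneg h ?_
        intro w _ _
        exact Finset.sum_nonneg fun w _ => mul_nonneg (sq_nonneg _) (hJ _ _)

lemma en_nonneg {K : V → V → ℝ} {pi : V → ℝ} (hJ : ∀ z w, 0 ≤ JJ K pi z w) (f : V → ℝ)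
    (A : Finset V) : 0 ≤ en K pi f A :=
  Finset.sum_nonneg fun z _ => Finset.sum_nonneg fun w _ => mul_nonneg (sq_nonneg _) (hJ _ _)

lemma mass_mono {pi : V → ℝ} (hp : ∀ z, 0 < pi z) (f : V → ℝ)
    {A B : Finset V} (h : A ⊆ B) : mass pi f A ≤ mass pi f B :=
  Finset.sum_le_sum_of_subset_of_nonneg h fun w _ _ => mul_nonneg (sq_nonneg _) (hp _).le

lemma mass_nonneg {pi : V → ℝ} (hp : ∀ z, 0 < pi z) (f : V → ℝ)
    (A : Finset V) : 0 ≤ mass pi f A :=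
  Finset.sum_nonneg fun w _ => mul_nonneg (sq_nonneg _) (hp _).le

lemma en_add_le {K : V → V → ℝ} {pi : V → ℝ} (hJ : ∀ z w, 0 ≤ JJ K pi z w) (f : V → ℝ)
    {A B C : Finset V} (hd : Disjoint A B) (hA : A ⊆ C) (hB : B ⊆ C) :
    en K pi f A + en K pi f B ≤ en K pi f C := by
  refine le_trans ?_ (en_mono hJ f (Finset.union_subset hA hB))
  unfold en
  rw [Finset.sum_union hd]
  refine add_le_add ?_ ?_
  · refine Finset.sum_le_sum fun z _ => ?_
    refine Finset.sum_le_sum_of_subset_of_nonneg Finset.subset_union_left ?_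
    intro w _ _
    exact mul_nonneg (sq_nonneg _) (hJ _ _)
  · refine Finset.sum_le_sum fun z _ => ?_
    refine Finset.sum_le_sum_of_subset_of_nonneg Finset.subset_union_right ?_
    intro w _ _
    exact mul_nonneg (sq_nonneg _) (hJ _ _)

lemma sum_biUnion_le_aux (N : Finset V) (B : V → Finset V) (h : V → ℝ) (hh : ∀ z, 0 ≤ h z) :
    ∑ z ∈ N.biUnion B, h z ≤ ∑ i ∈ N, ∑ z ∈ B i, h z := by
  induction N using Finset.induction_on with
  | empty => simp
  | insert a N ha ih =>
    rw [Finset.biUnion_insert, Finset.sum_insert ha]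
    have h1 := Finset.sum_union_inter (s₁ := B a) (s₂ := N.biUnion B) (f := h)
    have h2 : 0 ≤ ∑ z ∈ B a ∩ N.biUnion B, h z := Finset.sum_nonneg fun z _ => hh z
    linarith

namespace Sett

variable {G : SimpleGraph V} {K : V → V → ℝ} {pi : V → ℝ} {θ CD CP Cc : ℝ} {m : ℕ}

lemma jnn (S : Sett G K pi θ CD CP Cc m) (z w : V) : 0 ≤ JJ K pi z w :=
  mul_nonneg (S.pipos z).le (S.knn z w)

lemma jsymm (S : Sett G K pi θ CD CP Cc m) (z w : V) : JJ K pi z w = JJ K pi w z :=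
  S.rev z w

lemma jstep (S : Sett G K pi θ CD CP Cc m) {z w : V} (h : JJ K pi z w ≠ 0) :
    (G.dist z w : ℝ) ≤ 1 :=
  S.step z w (right_ne_zero_of_mul h)

lemma jsum (S : Sett G K pi θ CD CP Cc m) (z : V) : ∑ w, JJ K pi z w = pi z := by
  unfold JJ
  rw [← Finset.mul_sum, S.ksum, mul_one]

lemma tri (S : Sett G K pi θ CD CP Cc m) (x y z : V) :
    (G.dist x z : ℝ) ≤ G.dist x y + G.dist y z := by
  exact_mod_cast S.conn.dist_triangle

lemma dsymm (x y : V) : (G.dist x y : ℝ) = G.dist y x := by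
  rw [SimpleGraph.dist_comm]

lemma dist_le_diam (G : SimpleGraph V) (x y : V) : (G.dist x y : ℝ) ≤ gdiam G := by
  have h1 : G.dist x y ≤ univ.sup fun y => G.dist x y :=
    Finset.le_sup (f := fun y => G.dist x y) (Finset.mem_univ y)
  have h2 : (univ.sup fun y => G.dist x y) ≤ gdiam G :=
    Finset.le_sup (f := fun x => univ.sup fun y => G.dist x y) (Finset.mem_univ x)
  exact_mod_cast h1.trans h2

lemma vol_mono (S : Sett G K pi θ CD CP Cc m) {x y : V} {r s : ℝ}
    (h : (G.dist x y : ℝ) + r ≤ s) : vol G pi y r ≤ vol G pi x s := by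
  unfold vol
  refine Finset.sum_le_sum_of_subset_of_nonneg ?_ fun w _ _ => (S.pipos w).le
  intro z hz
  rw [mem_gball] at *
  linarith [S.tri x y z]

lemma vol_pow (S : Sett G K pi θ CD CP Cc m) (x : V) {r : ℝ} (hr : 0 < r) (j : ℕ) :
    vol G pi x (2 ^ j * r) ≤ CD ^ j * vol G pi x r := by
  induction j with
  | zero => simp
  | succ j ih =>
    have h := S.vd x (2 ^ j * r) (by positivity)
    have hC := S.hCD
    calc vol G pi x (2 ^ (j + 1) * r) = vol G pi x (2 * (2 ^ j * r)) := by ring_nf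
      _ ≤ CD * vol G pi x (2 ^ j * r) := h
      _ ≤ CD * (CD ^ j * vol G pi x r) := by gcongr
      _ = _ := by ring

lemma gball_univ (x : V) {r : ℝ} (h : (gdiam G : ℝ) ≤ r) : gball G x r = univ := by
  ext z
  simp only [mem_gball, Finset.mem_univ, iff_true]
  exact (dist_le_diam G x z).trans h

lemma vol_one (S : Sett G K pi θ CD CP Cc m) (x : V) {r : ℝ} (h : (gdiam G : ℝ) ≤ r) :
    vol G pi x r = 1 := by
  unfold vol
  rw [gball_univ x h, S.pisum]

lemma vol_pos (S : Sett G K pi θ CD CP Cc m) (x : V) {r : ℝ} (h : 0 ≤ r) :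
    0 < vol G pi x r := by
  unfold vol
  refine Finset.sum_pos (fun z _ => S.pipos z) ⟨x, ?_⟩
  rw [mem_gball]; simpa using h

/-- polynomial volume lower bound -/
lemma vol_lower (S : Sett G K pi θ CD CP Cc m) (x : V) {r : ℝ} (hr : 0 < r)
    (hrD : r ≤ gdiam G) : 1 / vol G pi x r ≤ (2 * (gdiam G : ℝ) / r) ^ m := by
  set D : ℝ := (gdiam G : ℝ) with hD
  have hx : (1 : ℝ) ≤ D / r := by rw [le_div_iff₀ hr]; linarith
  obtain ⟨n, hn1, hn2⟩ := exists_nat_pow_near hx (by norm_num : (1 : ℝ) < 2)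
  have h1 : D ≤ 2 ^ (n + 1) * r := by
    have := (div_lt_iff₀ hr).1 hn2
    linarith
  have h2 := S.vol_pow x hr (n + 1)
  rw [S.vol_one x h1] at h2
  have hv := S.vol_pos x hr.le
  have hC := S.hCD
  rw [div_le_iff₀ hv]
  refine h2.trans ?_
  gcongr
  calc CD ^ (n + 1) ≤ (2 ^ m) ^ (n + 1) := by
        have := S.hCDm
        gcongr
    _ = (2 * 2 ^ n) ^ m := by rw [← pow_mul, ← pow_succ', ← pow_mul, mul_comm]
    _ ≤ (2 * D / r) ^ m := by
        gcongr
        rw [mul_div_assoc]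
        gcongr

lemma pi_lower (S : Sett G K pi θ CD CP Cc m) (x : V) (hD : (1 : ℝ) ≤ gdiam G) :
    1 / pi x ≤ (4 * (gdiam G : ℝ)) ^ m := by
  have h := S.vol_lower x (r := 1 / 2) (by norm_num) (by linarith)
  have : vol G pi x (1 / 2) = pi x := by
    unfold vol
    have : gball G x (1 / 2) = {x} := by
      ext z
      rw [mem_gball, Finset.mem_singleton]
      constructor
      · intro h
        have h1 : (G.dist x z : ℝ) < (1 : ℕ) := by push_cast; linarith
        have h2 : G.dist x z = 0 := by
          have := Nat.cast_lt.1 h1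
          omega
        exact ((S.conn.dist_eq_zero_iff).1 h2).symm
      · rintro rfl; simp
    rw [this]; simp
  rw [this] at h
  refine h.trans (le_of_eq ?_)
  congr 1
  ring

/-- nets with bounded overlap -/
lemma exists_net (S : Sett G K pi θ CD CP Cc m) (A : Finset V) {r : ℝ} (hr : 0 < r) :
    ∃ N : Finset V, N ⊆ A ∧ (∀ z ∈ A, ∃ i ∈ N, (G.dist i z : ℝ) ≤ r) ∧
      ∀ z, ((N.filter fun i => (G.dist i z : ℝ) ≤ 4 * r).card : ℝ) ≤ CD ^ 5 := by
  have hne : (A.powerset.filter fun N => ∀ i ∈ N, ∀ j ∈ N, i ≠ j → r < (G.dist i j : ℝ)).Nonempty :=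
    ⟨∅, by simp⟩
  obtain ⟨N, hN, hmax⟩ := Finset.exists_max_image _ Finset.card hne
  rw [Finset.mem_filter, Finset.mem_powerset] at hN
  obtain ⟨hNA, hsep⟩ := hN
  refine ⟨N, hNA, ?_, ?_⟩
  · intro z hz
    by_contra hcon
    push Not at hcon
    have hzN : z ∉ N := by
      intro h
      have := hcon z h
      simp at this
      linarith
    have := hmax (insert z N) (by
      rw [Finset.mem_filter, Finset.mem_powerset]
      refine ⟨Finset.insert_subset hz hNA, ?_⟩
      intro i hi j hj hij
      rw [Finset.mem_insert] at hi hj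
      rcases hi with rfl | hi <;> rcases hj with rfl | hj
      · exact absurd rfl hij
      · rw [dsymm]; exact hcon j hj
      · exact hcon i hi
      · exact hsep i hi j hj hij)
    rw [Finset.card_insert_of_notMem hzN] at this
    omega
  · intro z
    set M := N.filter fun i => (G.dist i z : ℝ) ≤ 4 * r with hM
    have hv := S.vol_pos z (r := 5 * r) (by positivity)
    have hC : 0 < CD ^ 5 := pow_pos (lt_of_lt_of_le one_pos S.hCD) 5
    have h1 : ∀ i ∈ M, vol G pi z (5 * r) / CD ^ 5 ≤ vol G pi i (r / 2) := by
      intro i hi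
      rw [hM, Finset.mem_filter] at hi
      rw [div_le_iff₀' hC]
      refine le_trans ?_ (S.vol_pow i (r := r / 2) (by positivity) 5)
      apply S.vol_mono
      linarith [hi.2]
    have h2 : ∑ i ∈ M, vol G pi i (r / 2) ≤ vol G pi z (5 * r) := by
      unfold vol
      rw [← Finset.sum_biUnion]
      · refine Finset.sum_le_sum_of_subset_of_nonneg ?_ fun w _ _ => (S.pipos w).le
        intro w hw
        rw [Finset.mem_biUnion] at hw
        obtain ⟨i, hi, hw⟩ := hw
        rw [hM, Finset.mem_filter] at hi
        rw [mem_gball] at *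
        have := S.tri z i w
        rw [dsymm z i] at this
        linarith [hi.2]
      · intro i hi j hj hij
        simp only [Function.onFun]
        rw [Finset.disjoint_left]
        intro w hw1 hw2
        rw [mem_gball] at *
        have hi' : i ∈ N := (Finset.mem_filter.1 hi).1
        have hj' : j ∈ N := (Finset.mem_filter.1 hj).1
        have h3 := hsep i hi' j hj' hij
        have h4 := S.tri i w j
        rw [dsymm w j] at h4
        linarith
    have h3 := Finset.sum_le_sum h1
    rw [Finset.sum_const, nsmul_eq_mul] at h3
    have h4 := h3.trans h2
    rw [mul_div_assoc', div_le_iff₀ hC, mul_comm] at h4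
    exact le_of_mul_le_mul_left h4 hv

lemma overlap (S : Sett G K pi θ CD CP Cc m) {N : Finset V} {r : ℝ}
    (hN : ∀ z, ((N.filter fun i => (G.dist i z : ℝ) ≤ 4 * r).card : ℝ) ≤ CD ^ 5)
    (U : Finset V) (h : V → ℝ) (hh : ∀ z, 0 ≤ h z) (s : ℝ) (hs : s ≤ 4 * r)
    (hU : ∀ i ∈ N, gball G i s ⊆ U) :
    ∑ i ∈ N, ∑ z ∈ gball G i s, h z ≤ CD ^ 5 * ∑ z ∈ U, h z := by
  calc ∑ i ∈ N, ∑ z ∈ gball G i s, h z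
      ≤ ∑ i ∈ N, ∑ z ∈ U, if (G.dist i z : ℝ) ≤ 4 * r then h z else 0 := by
        refine Finset.sum_le_sum fun i hi => ?_
        rw [← Finset.sum_filter]
        refine Finset.sum_le_sum_of_subset_of_nonneg ?_ fun w _ _ => hh w
        intro z hz
        rw [Finset.mem_filter]
        refine ⟨hU i hi hz, ?_⟩
        rw [mem_gball] at hz
        linarith
    _ = ∑ z ∈ U, ((N.filter fun i => (G.dist i z : ℝ) ≤ 4 * r).card : ℝ) * h z := by
        rw [Finset.sum_comm]
        refine Finset.sum_congr rfl fun z _ => ?_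
        rw [← Finset.sum_filter, Finset.sum_const, nsmul_eq_mul]
    _ ≤ ∑ z ∈ U, CD ^ 5 * h z := by
        refine Finset.sum_le_sum fun z _ => ?_
        exact mul_le_mul_of_nonneg_right (hN z) (hh z)
    _ = _ := by rw [Finset.mul_sum]

lemma overlap_en (S : Sett G K pi θ CD CP Cc m) {N : Finset V} {r : ℝ}
    (hN : ∀ z, ((N.filter fun i => (G.dist i z : ℝ) ≤ 4 * r).card : ℝ) ≤ CD ^ 5)
    (U : Finset V) (f : V → ℝ) (s : ℝ) (hs : s ≤ 4 * r)
    (hU : ∀ i ∈ N, gball G i s ⊆ U) :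
    ∑ i ∈ N, en K pi f (gball G i s) ≤ CD ^ 5 * en K pi f U := by
  refine le_trans ?_ (S.overlap hN U (fun z => ∑ w ∈ U, (f z - f w) ^ 2 * JJ K pi z w) ?_ s hs hU)
  · refine Finset.sum_le_sum fun i hi => ?_
    refine Finset.sum_le_sum fun z _ => ?_
    refine Finset.sum_le_sum_of_subset_of_nonneg (hU i hi) ?_
    intro w _ _
    exact mul_nonneg (sq_nonneg _) (S.jnn _ _)
  · intro z
    exact Finset.sum_nonneg fun w _ => mul_nonneg (sq_nonneg _) (S.jnn _ _)

/-- Nash type inequality on a region -/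
lemma nash (S : Sett G K pi θ CD CP Cc m) (f : V → ℝ) (A U : Finset V) {r : ℝ} (hr : 0 < r)
    (hrD : r ≤ gdiam G) (hU : ∀ z ∈ A, gball G z r ⊆ U) :
    mass pi f A ≤ CD ^ 5 * (CP * r ^ θ * en K pi f U +
      (2 * (gdiam G : ℝ) / r) ^ m * (∑ z, |f z| * pi z) ^ 2) := by
  obtain ⟨N, hNA, hcov, hov⟩ := S.exists_net A hr
  have hU' : ∀ i ∈ N, gball G i r ⊆ U := fun i hi => hU i (hNA hi)
  set L := ∑ z, |f z| * pi z with hL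
  have habs : ∀ z, 0 ≤ |f z| * pi z := fun z => mul_nonneg (abs_nonneg _) (S.pipos z).le
  have hL0 : 0 ≤ L := Finset.sum_nonneg fun z _ => habs z
  have hQ : 0 ≤ (2 * (gdiam G : ℝ) / r) ^ m := by positivity
  calc mass pi f A ≤ ∑ i ∈ N, mass pi f (gball G i r) := by
        unfold mass
        calc ∑ z ∈ A, f z ^ 2 * pi z
            ≤ ∑ z ∈ N.biUnion fun i => gball G i r, f z ^ 2 * pi z := by
              refine Finset.sum_le_sum_of_subset_of_nonneg ?_
                fun w _ _ => mul_nonneg (sq_nonneg _) (S.pipos _).le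
              intro z hz
              obtain ⟨i, hi, h⟩ := hcov z hz
              rw [Finset.mem_biUnion]
              exact ⟨i, hi, (mem_gball _ _ _ _).2 h⟩
          _ ≤ _ := sum_biUnion_le_aux N (fun i => gball G i r) _ fun w => mul_nonneg (sq_nonneg _) (S.pipos _).le
    _ ≤ ∑ i ∈ N, (CP * r ^ θ * en K pi f (gball G i r) +
          (2 * (gdiam G : ℝ) / r) ^ m * (L * ∑ z ∈ gball G i r, |f z| * pi z)) := by
        refine Finset.sum_le_sum fun i _ => (S.pI i r hr f).trans ?_
        refine add_le_add le_rfl ?_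
        rw [div_eq_mul_one_div, mul_comm]
        refine mul_le_mul (S.vol_lower i hr hrD) ?_ (sq_nonneg _) hQ
        have h1 : |∑ z ∈ gball G i r, f z * pi z| ≤ ∑ z ∈ gball G i r, |f z| * pi z := by
          refine (Finset.abs_sum_le_sum_abs _ _).trans (le_of_eq ?_)
          refine Finset.sum_congr rfl fun z _ => ?_
          rw [abs_mul, abs_of_pos (S.pipos z)]
        have h2 : ∑ z ∈ gball G i r, |f z| * pi z ≤ L :=
          Finset.sum_le_sum_of_subset_of_nonneg (Finset.subset_univ _) fun z _ _ => habs z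
        have h3 : 0 ≤ ∑ z ∈ gball G i r, |f z| * pi z := Finset.sum_nonneg fun z _ => habs z
        rw [← sq_abs]
        nlinarith [abs_nonneg (∑ z ∈ gball G i r, f z * pi z)]
    _ = CP * r ^ θ * ∑ i ∈ N, en K pi f (gball G i r) +
          (2 * (gdiam G : ℝ) / r) ^ m * (L * ∑ i ∈ N, ∑ z ∈ gball G i r, |f z| * pi z) := by
        rw [Finset.sum_add_distrib, ← Finset.mul_sum, ← Finset.mul_sum, ← Finset.mul_sum]
    _ ≤ CP * r ^ θ * (CD ^ 5 * en K pi f U) +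
          (2 * (gdiam G : ℝ) / r) ^ m * (L * (CD ^ 5 * L)) := by
        have h1 := S.overlap_en hov U f r (by linarith) hU'
        have h2 := S.overlap hov univ (fun z => |f z| * pi z) habs r (by linarith)
          (fun i _ => Finset.subset_univ _)
        have := S.hCP
        gcongr
    _ = _ := by ring

end Sett

lemma max_sq_aux (a b c d : ℝ) : (max a b - max c d) ^ 2 ≤ (a - c) ^ 2 + (b - d) ^ 2 := by
  have h := abs_max_sub_max_le_max a b c d
  have h1 : (max a b - max c d) ^ 2 = |max a b - max c d| ^ 2 := (sq_abs _).symm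
  rw [h1, ← sq_abs (a - c), ← sq_abs (b - d)]
  rcases le_total (|a - c|) (|b - d|) with h2 | h2
  · rw [max_eq_right h2] at h
    nlinarith [abs_nonneg (max a b - max c d), abs_nonneg (a - c), sq_nonneg |a - c|]
  · rw [max_eq_left h2] at h
    nlinarith [abs_nonneg (max a b - max c d), abs_nonneg (a - c), sq_nonneg |b - d|]

/-- finite maxima of cut-off functions -/
lemma exists_sup_cutoff (N : Finset V) (σ : V → V → ℝ) (h0 : ∀ i z, 0 ≤ σ i z)
    (h1 : ∀ i z, σ i z ≤ 1) :
    ∃ ψ : V → ℝ, (∀ z, 0 ≤ ψ z) ∧ (∀ z, ψ z ≤ 1) ∧ (∀ z, (∃ i ∈ N, σ i z = 1) → ψ z = 1) ∧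
      (∀ z, (∀ i ∈ N, σ i z = 0) → ψ z = 0) ∧
      ∀ z w, (ψ z - ψ w) ^ 2 ≤ ∑ i ∈ N, (σ i z - σ i w) ^ 2 := by
  induction N using Finset.induction_on with
  | empty => exact ⟨fun _ => 0, by simp⟩
  | insert a N ha ih =>
    obtain ⟨ψ, p0, p1, pe, pz, pd⟩ := ih
    refine ⟨fun z => max (σ a z) (ψ z), fun z => le_max_of_le_left (h0 a z),
      fun z => max_le (h1 a z) (p1 z), ?_, ?_, ?_⟩
    · rintro z ⟨i, hi, hz⟩
      rw [Finset.mem_insert] at hi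
      rcases hi with rfl | hi
      · simp only [hz]; exact max_eq_left (p1 z)
      · simp only [pe z ⟨i, hi, hz⟩]; exact max_eq_right (h1 a z)
    · intro z hz
      have e1 := hz a (Finset.mem_insert_self _ _)
      have e2 := pz z fun i hi => hz i (Finset.mem_insert_of_mem hi)
      simp [e1, e2]
    · intro z w
      rw [Finset.sum_insert ha]
      exact (max_sq_aux _ _ _ _).trans (add_le_add le_rfl (pd z w))

/-- exterior of a ball -/
noncomputable def extr (G : SimpleGraph V) (y : V) (R : ℝ) : Finset V :=
  univ.filter fun z => R ≤ (G.dist y z : ℝ)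

lemma mem_ext (G : SimpleGraph V) (y z : V) (R : ℝ) :
    z ∈ extr G y R ↔ R ≤ (G.dist y z : ℝ) := by
  simp [extr]

/-- closed annulus -/
noncomputable def ann (G : SimpleGraph V) (y : V) (R R' : ℝ) : Finset V :=
  univ.filter fun z => R ≤ (G.dist y z : ℝ) ∧ (G.dist y z : ℝ) ≤ R'

lemma mem_ann (G : SimpleGraph V) (y z : V) (R R' : ℝ) :
    z ∈ ann G y R R' ↔ R ≤ (G.dist y z : ℝ) ∧ (G.dist y z : ℝ) ≤ R' := by
  simp [ann]

lemma cacc_alg (a b p q : ℝ) :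
    (a - b) ^ 2 * (p ^ 2 + q ^ 2) / 4 - (a ^ 2 + b ^ 2) * (p - q) ^ 2 ≤
      (a - b) * (p ^ 2 * a - q ^ 2 * b) := by
  nlinarith [sq_nonneg ((a - b) * (p + q) / 2 + (a + b) * (p - q)),
    sq_nonneg ((a - b) * (p - q)), sq_nonneg ((a + b) * (p - q)), sq_nonneg ((a - b) * (p + q))]

namespace Sett

variable {G : SimpleGraph V} {K : V → V → ℝ} {pi : V → ℝ} {θ CD CP Cc : ℝ} {m : ℕ}

lemma exists_cutoff (S : Sett G K pi θ CD CP Cc m) (y : V) (R ρ : ℝ) (hρ : 1 ≤ ρ) :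
    ∃ φ : V → ℝ, (∀ z, 0 ≤ φ z) ∧ (∀ z, φ z ≤ 1) ∧
      (∀ z, R ≤ (G.dist y z : ℝ) → φ z = 1) ∧
      (∀ z, (G.dist y z : ℝ) < R - ρ → φ z = 0) ∧
      (∀ z w, JJ K pi z w ≠ 0 → φ z ≠ φ w →
        z ∈ ann G y (R - 2 * ρ) (R + 3 * ρ) ∧ w ∈ ann G y (R - 2 * ρ) (R + 3 * ρ)) ∧
      ∀ f : V → ℝ, ∑ z, ∑ w, f z ^ 2 * (φ z - φ w) ^ 2 * JJ K pi z w ≤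
        Cc * CD ^ 5 * (en K pi f (ann G y (R - 2 * ρ) (R + 3 * ρ)) +
          ρ ^ (-θ) * mass pi f (ann G y (R - 2 * ρ) (R + 3 * ρ))) := by
  obtain ⟨N, hNA, hcov, hov⟩ := S.exists_net (ann G y R (R + ρ)) (r := ρ / 2) (by linarith)
  choose σ s0 s1 se sz sf using fun i : V => S.cs i ρ hρ
  obtain ⟨ψ, p0, p1, pe, pz, pd⟩ := exists_sup_cutoff N σ s0 s1
  set U := ann G y (R - 2 * ρ) (R + 3 * ρ) with hU
  have hNd : ∀ i ∈ N, R ≤ (G.dist y i : ℝ) ∧ (G.dist y i : ℝ) ≤ R + ρ :=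
    fun i hi => (mem_ann _ _ _ _ _).1 (hNA hi)
  have hψ1 : ∀ z, R ≤ (G.dist y z : ℝ) → (G.dist y z : ℝ) ≤ R + ρ → ψ z = 1 := by
    intro z h1 h2
    obtain ⟨i, hi, h⟩ := hcov z ((mem_ann _ _ _ _ _).2 ⟨h1, h2⟩)
    exact pe z ⟨i, hi, se i z h⟩
  have hψ0 : ∀ z, (G.dist y z : ℝ) < R - ρ → ψ z = 0 := by
    intro z hz
    refine pz z fun i hi => sz i z ?_
    have h1 := S.tri y z i
    rw [dsymm z i] at h1
    linarith [(hNd i hi).1]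
  set φ : V → ℝ := fun z => if R ≤ (G.dist y z : ℝ) then 1 else ψ z with hφ
  have hφψ : ∀ z, (G.dist y z : ℝ) ≤ R + ρ → φ z = ψ z := by
    intro z hz
    simp only [hφ]
    split_ifs with h
    · exact (hψ1 z h hz).symm
    · rfl
  have hφ1 : ∀ z, R ≤ (G.dist y z : ℝ) → φ z = 1 := by
    intro z hz; simp [hφ, hz]
  have hφ0 : ∀ z, (G.dist y z : ℝ) < R - ρ → φ z = 0 := by
    intro z hz
    rw [hφψ z (by linarith)]; exact hψ0 z hz
  have hnear : ∀ z w, JJ K pi z w ≠ 0 → φ z ≠ φ w →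
      (G.dist y z : ℝ) ≤ R + ρ ∧ (G.dist y w : ℝ) ≤ R + ρ ∧
      R - 2 * ρ ≤ (G.dist y z : ℝ) ∧ R - 2 * ρ ≤ (G.dist y w : ℝ) := by
    intro z w hJ hne
    have h1 := S.jstep hJ
    have h2 := S.tri y z w
    have h3 := S.tri y w z
    rw [dsymm w z] at h3
    refine ⟨?_, ?_, ?_, ?_⟩
    · by_contra hc; push Not at hc
      exact hne (by rw [hφ1 z (by linarith), hφ1 w (by linarith)])
    · by_contra hc; push Not at hc
      exact hne (by rw [hφ1 z (by linarith), hφ1 w (by linarith)])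
    · by_contra hc; push Not at hc
      exact hne (by rw [hφ0 z (by linarith), hφ0 w (by linarith)])
    · by_contra hc; push Not at hc
      exact hne (by rw [hφ0 z (by linarith), hφ0 w (by linarith)])
  refine ⟨φ, ?_, ?_, hφ1, hφ0, ?_, ?_⟩
  · intro z; simp only [hφ]; split_ifs
    · norm_num
    · exact p0 z
  · intro z; simp only [hφ]; split_ifs
    · norm_num
    · exact p1 z
  · intro z w hJ hne
    obtain ⟨h1, h2, h3, h4⟩ := hnear z w hJ hne
    rw [mem_ann, mem_ann]
    exact ⟨⟨h3, by linarith⟩, h4, by linarith⟩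
  · intro f
    have hball : ∀ i ∈ N, gball G i (2 * ρ) ⊆ U := by
      intro i hi z hz
      rw [mem_gball] at hz
      rw [hU, mem_ann]
      have h1 := S.tri y i z
      have h2 := S.tri y z i
      rw [dsymm z i] at h2
      obtain ⟨h3, h4⟩ := hNd i hi
      constructor <;> linarith
    calc ∑ z, ∑ w, f z ^ 2 * (φ z - φ w) ^ 2 * JJ K pi z w
        ≤ ∑ z, ∑ w, ∑ i ∈ N, f z ^ 2 * (σ i z - σ i w) ^ 2 * JJ K pi z w := by
          refine Finset.sum_le_sum fun z _ => Finset.sum_le_sum fun w _ => ?_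
          rw [← Finset.sum_mul, ← Finset.mul_sum]
          by_cases hJ : JJ K pi z w = 0
          · simp [hJ]
          refine mul_le_mul_of_nonneg_right ?_ (S.jnn z w)
          refine mul_le_mul_of_nonneg_left ?_ (sq_nonneg _)
          by_cases hne : φ z = φ w
          · rw [hne]; simp only [sub_self]
            rw [zero_pow two_ne_zero]
            exact Finset.sum_nonneg fun i _ => sq_nonneg _
          obtain ⟨h1, h2, _, _⟩ := hnear z w hJ hne
          rw [hφψ z h1, hφψ w h2]
          exact pd z w
      _ = ∑ i ∈ N, ∑ z, ∑ w, f z ^ 2 * (σ i z - σ i w) ^ 2 * JJ K pi z w := by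
          rw [Finset.sum_comm]
          rw [Finset.sum_congr rfl fun w _ => Finset.sum_comm]
          rw [Finset.sum_comm]
          refine Finset.sum_congr rfl fun i _ => Finset.sum_comm
      _ ≤ ∑ i ∈ N, Cc * (en K pi f (gball G i (2 * ρ)) +
            ρ ^ (-θ) * mass pi f (gball G i (2 * ρ))) :=
          Finset.sum_le_sum fun i _ => sf i f
      _ = Cc * (∑ i ∈ N, en K pi f (gball G i (2 * ρ)) +
            ρ ^ (-θ) * ∑ i ∈ N, mass pi f (gball G i (2 * ρ))) := by
          rw [← Finset.mul_sum, Finset.sum_add_distrib, ← Finset.mul_sum]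
      _ ≤ Cc * (CD ^ 5 * en K pi f U + ρ ^ (-θ) * (CD ^ 5 * mass pi f U)) := by
          have h1 := S.overlap_en hov U f (2 * ρ) (by linarith) hball
          have h2 := S.overlap hov U (fun z => f z ^ 2 * pi z)
            (fun z => mul_nonneg (sq_nonneg _) (S.pipos z).le) (2 * ρ) (by linarith) hball
          have := S.hCc
          have h3 : 0 ≤ ρ ^ (-θ) := Real.rpow_nonneg (by linarith) _
          unfold mass
          gcongr
      _ = _ := by ring

/-- integration by parts -/
lemma ibp (S : Sett G K pi θ CD CP Cc m) (f h : V → ℝ) :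
    ∑ z, ∑ w, (f z - f w) * (h z - h w) * JJ K pi z w =
      2 * ∑ z, h z * (f z - ∑ w, K z w * f w) * pi z := by
  have e1 : ∑ z, ∑ w, (f z - f w) * h z * JJ K pi z w =
      ∑ z, h z * (f z - ∑ w, K z w * f w) * pi z := by
    refine Finset.sum_congr rfl fun z _ => ?_
    have : f z = ∑ w, K z w * f z := by rw [← Finset.sum_mul, S.ksum, one_mul]
    conv_rhs => rw [this]
    rw [← Finset.sum_sub_distrib, Finset.mul_sum, Finset.sum_mul]
    refine Finset.sum_congr rfl fun w _ => ?_
    unfold JJ; ring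
  have e2 : ∑ z, ∑ w, (f z - f w) * h w * JJ K pi z w =
      - ∑ z, ∑ w, (f z - f w) * h z * JJ K pi z w := by
    rw [Finset.sum_comm, ← Finset.sum_neg_distrib]
    refine Finset.sum_congr rfl fun z _ => ?_
    rw [← Finset.sum_neg_distrib]
    refine Finset.sum_congr rfl fun w _ => ?_
    rw [S.jsymm w z]; ring
  calc ∑ z, ∑ w, (f z - f w) * (h z - h w) * JJ K pi z w
      = ∑ z, ∑ w, (f z - f w) * h z * JJ K pi z w - ∑ z, ∑ w, (f z - f w) * h w * JJ K pi z w := by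
        rw [← Finset.sum_sub_distrib]
        refine Finset.sum_congr rfl fun z _ => ?_
        rw [← Finset.sum_sub_distrib]
        refine Finset.sum_congr rfl fun w _ => ?_
        ring
    _ = _ := by rw [e2, e1]; ring

lemma swap_sum (S : Sett G K pi θ CD CP Cc m) (a : V → V → ℝ) :
    ∑ z, ∑ w, a w z * JJ K pi z w = ∑ z, ∑ w, a z w * JJ K pi z w := by
  rw [Finset.sum_comm]
  refine Finset.sum_congr rfl fun z _ => Finset.sum_congr rfl fun w _ => ?_
  rw [S.jsymm]

/-- Caccioppoli inequality -/
lemma cacc (S : Sett G K pi θ CD CP Cc m) (y : V) (g φ : V → ℝ) (L R : ℝ)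
    (hg : ∀ z, z ≠ y → g z - ∑ w, K z w * g w = -1) (hL : ∑ z, |g z| * pi z ≤ L)
    (h0 : ∀ z, 0 ≤ φ z) (h1 : ∀ z, φ z ≤ 1) (hy : φ y = 0)
    (hR : ∀ z, R ≤ (G.dist y z : ℝ) → φ z = 1) :
    en K pi g (extr G y R) ≤
      4 * ∑ z, ∑ w, g z ^ 2 * (φ z - φ w) ^ 2 * JJ K pi z w + 4 * L := by
  have e1 := S.ibp g (fun z => φ z ^ 2 * g z)
  have e2 : ∑ z, φ z ^ 2 * g z * (g z - ∑ w, K z w * g w) * pi z ≤ L := by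
    refine le_trans (Finset.sum_le_sum fun z _ => ?_) hL
    refine mul_le_mul_of_nonneg_right ?_ (S.pipos z).le
    by_cases hz : z = y
    · rw [hz, hy]; simp
    rw [hg z hz]
    have : φ z ^ 2 ≤ 1 := by nlinarith [h0 z, h1 z]
    nlinarith [abs_nonneg (g z), neg_abs_le (g z), sq_nonneg (φ z)]
  have e3 : ∑ z, ∑ w, ((g z - g w) ^ 2 * (φ z ^ 2 + φ w ^ 2) / 4 * JJ K pi z w -
      (g z ^ 2 * (φ z - φ w) ^ 2 * JJ K pi z w + g w ^ 2 * (φ w - φ z) ^ 2 * JJ K pi z w)) ≤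
      2 * L := by
    refine le_trans ?_ (e1.le.trans (by linarith))
    refine Finset.sum_le_sum fun z _ => Finset.sum_le_sum fun w _ => ?_
    have := mul_le_mul_of_nonneg_right (cacc_alg (g z) (g w) (φ z) (φ w)) (S.jnn z w)
    refine le_trans (le_of_eq ?_) this
    ring
  have e4 := S.swap_sum (fun z w => g z ^ 2 * (φ z - φ w) ^ 2)
  simp only [Finset.sum_sub_distrib, Finset.sum_add_distrib] at e3
  rw [e4] at e3
  have e5 : en K pi g (extr G y R) / 2 ≤
      ∑ z, ∑ w, (g z - g w) ^ 2 * (φ z ^ 2 + φ w ^ 2) / 4 * JJ K pi z w := by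
    have hnn : ∀ z w, 0 ≤ (g z - g w) ^ 2 * (φ z ^ 2 + φ w ^ 2) / 4 * JJ K pi z w :=
      fun z w => mul_nonneg (by positivity) (S.jnn z w)
    calc en K pi g (extr G y R) / 2
        = ∑ z ∈ extr G y R, ∑ w ∈ extr G y R,
            (g z - g w) ^ 2 * (φ z ^ 2 + φ w ^ 2) / 4 * JJ K pi z w := by
          unfold en
          rw [Finset.sum_div]
          refine Finset.sum_congr rfl fun z hz => ?_
          rw [Finset.sum_div]
          refine Finset.sum_congr rfl fun w hw => ?_
          rw [hR z ((mem_ext _ _ _ _).1 hz), hR w ((mem_ext _ _ _ _).1 hw)]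
          ring
      _ ≤ ∑ z ∈ extr G y R, ∑ w,
            (g z - g w) ^ 2 * (φ z ^ 2 + φ w ^ 2) / 4 * JJ K pi z w := by
          refine Finset.sum_le_sum fun z _ => ?_
          exact Finset.sum_le_sum_of_subset_of_nonneg (Finset.subset_univ _) fun w _ _ => hnn z w
      _ ≤ _ := Finset.sum_le_sum_of_subset_of_nonneg (Finset.subset_univ _)
            fun z _ _ => Finset.sum_nonneg fun w _ => hnn z w
  linarith

/-- hole filling -/
lemma hole (S : Sett G K pi θ CD CP Cc m) (y : V) (g : V → ℝ) (L R ρ : ℝ)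
    (hg : ∀ z, z ≠ y → g z - ∑ w, K z w * g w = -1) (hL : ∑ z, |g z| * pi z ≤ L)
    (hρ : 1 ≤ ρ) (hR : 5 * ρ < R) :
    (1 + 4 * (Cc * CD ^ 5)) * en K pi g (extr G y R) ≤
      4 * (Cc * CD ^ 5) * (en K pi g (extr G y (R - 6 * ρ)) +
        ρ ^ (-θ) * mass pi g (extr G y (R - 6 * ρ))) + 4 * L := by
  obtain ⟨φ, h0, h1, hφ1, hφ0, -, hφ⟩ := S.exists_cutoff y (R - 4 * ρ) ρ hρ
  have hy : φ y = 0 := hφ0 y (by simp; linarith)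
  have c1 := S.cacc y g φ L (R - 4 * ρ) hg hL h0 h1 hy hφ1
  have c2 := hφ g
  set U := ann G y (R - 4 * ρ - 2 * ρ) (R - 4 * ρ + 3 * ρ) with hU
  have c3 : en K pi g (extr G y R) ≤ en K pi g (extr G y (R - 4 * ρ)) :=
    en_mono S.jnn g (by intro z; rw [mem_ext, mem_ext]; intro h; linarith)
  have hUs : U ⊆ extr G y (R - 6 * ρ) := by
    intro z; rw [mem_ext, hU, mem_ann]; intro h; linarith [h.1]
  have c4 : en K pi g U + en K pi g (extr G y R) ≤ en K pi g (extr G y (R - 6 * ρ)) := by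
    refine en_add_le S.jnn g ?_ hUs ?_
    · rw [Finset.disjoint_left]
      intro z; rw [mem_ext, hU, mem_ann]; intro h h'; linarith [h.2]
    · intro z; rw [mem_ext, mem_ext]; intro h; linarith
  have c5 : mass pi g U ≤ mass pi g (extr G y (R - 6 * ρ)) := mass_mono S.pipos g hUs
  have hC : 0 ≤ Cc * CD ^ 5 := mul_nonneg S.hCc.le (pow_nonneg (by linarith [S.hCD]) 5)
  have hρθ : 0 ≤ ρ ^ (-θ) := Real.rpow_nonneg (by linarith) _
  have c6 := mul_le_mul_of_nonneg_left c4 hC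
  have c7 := mul_le_mul_of_nonneg_left (mul_le_mul_of_nonneg_left c5 hρθ) hC
  nlinarith

end Sett

lemma consts_aux (γ E θ : ℝ) (m : ℕ) (hγ0 : 0 ≤ γ) (hγ : γ < 1) (hE : 0 < E) (hθ : 2 ≤ θ) :
    ∃ q δ β : ℝ, 0 < q ∧ q < 1 ∧ 0 < δ ∧ δ ≤ q - q ^ 2 ∧ 0 ≤ β ∧ β < 1 ∧
      γ + E * (δ / ((1 - q) / 6)) ^ θ ≤ β * ((q ^ 2) ^ θ * (q ^ 2) ^ m) := by
  set γ1 := (1 + γ) / 2 with hγ1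
  have hlim : Filter.Tendsto (fun q : ℝ => (q ^ 2) ^ θ * (q ^ 2) ^ m) (nhdsWithin 1 (Set.Iio 1))
      (nhds (((1 : ℝ) ^ 2) ^ θ * ((1 : ℝ) ^ 2) ^ m)) := by
    apply Filter.Tendsto.mono_left _ nhdsWithin_le_nhds
    have hc : ContinuousAt (fun q : ℝ => (q ^ 2) ^ θ * (q ^ 2) ^ m) 1 := by
      apply ContinuousAt.mul
      · apply ContinuousAt.rpow_const (by fun_prop)
        left; norm_num
      · fun_prop
    exact hc
  have h1 : γ1 < ((1 : ℝ) ^ 2) ^ θ * ((1 : ℝ) ^ 2) ^ m := by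
    simp; rw [hγ1]; linarith
  have ev := hlim.eventually (lt_mem_nhds h1)
  have ev2 : ∀ᶠ q in nhdsWithin (1 : ℝ) (Set.Iio 1), q ∈ Set.Ioo (0 : ℝ) 1 :=
    Ioo_mem_nhdsLT (by norm_num)
  obtain ⟨q, hq, hq0, hq1⟩ := (ev.and ev2).exists
  set Q := (q ^ 2) ^ θ * (q ^ 2) ^ m with hQ
  have hQ0 : 0 < Q := by positivity
  set η := min 1 ((γ1 - γ) / E) with hη
  have hη0 : 0 < η := lt_min one_pos (div_pos (by rw [hγ1]; linarith) hE)
  set κ := (1 - q) / 6 with hκ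
  have hκ0 : 0 < κ := by rw [hκ]; linarith
  refine ⟨q, min (q - q ^ 2) (κ * η), γ1 / Q, hq0, hq1, ?_, min_le_left _ _, ?_, ?_, ?_⟩
  · exact lt_min (by nlinarith) (by positivity)
  · have : 0 ≤ γ1 := by rw [hγ1]; linarith
    positivity
  · rw [div_lt_one hQ0]; exact hq
  · rw [div_mul_cancel₀ _ hQ0.ne']
    have h2 : min (q - q ^ 2) (κ * η) / κ ≤ η := by
      rw [div_le_iff₀' hκ0]; exact min_le_right _ _
    have h3 : 0 ≤ min (q - q ^ 2) (κ * η) / κ := by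
      refine div_nonneg (le_min (by nlinarith) (by positivity)) hκ0.le
    have h4 : (min (q - q ^ 2) (κ * η) / κ) ^ θ ≤ η := by
      calc (min (q - q ^ 2) (κ * η) / κ) ^ θ ≤ η ^ θ := Real.rpow_le_rpow h3 h2 (by linarith)
        _ ≤ η ^ (1 : ℝ) := Real.rpow_le_rpow_of_exponent_ge hη0 (min_le_left _ _) (by linarith)
        _ = η := Real.rpow_one η
    have h5 : E * η ≤ γ1 - γ := by
      rw [← le_div_iff₀' hE]; exact min_le_right _ _
    have h6 := mul_le_mul_of_nonneg_left h4 hE.le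
    rw [← hκ]
    linarith

namespace Sett

variable {G : SimpleGraph V} {K : V → V → ℝ} {pi : V → ℝ} {θ CD CP Cc : ℝ} {m : ℕ}

lemma mass_univ_le (S : Sett G K pi θ CD CP Cc m) (hD : (1 : ℝ) ≤ gdiam G) (g : V → ℝ) (L : ℝ)
    (hL : ∑ z, |g z| * pi z ≤ L) :
    mass pi g univ ≤ (4 * (gdiam G : ℝ)) ^ m * L ^ 2 := by
  have hnn : ∀ z, 0 ≤ |g z| * pi z := fun z => mul_nonneg (abs_nonneg _) (S.pipos z).le
  have hL0 : 0 ≤ L := (Finset.sum_nonneg fun z _ => hnn z).trans hL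
  set Q := (4 * (gdiam G : ℝ)) ^ m with hQ
  have hQ0 : 0 ≤ Q := by positivity
  have hb : ∀ z, |g z| ≤ Q * L := by
    intro z
    have h1 : |g z| * pi z ≤ L :=
      (Finset.single_le_sum (fun z _ => hnn z) (Finset.mem_univ z)).trans hL
    have h2 := S.pi_lower z hD
    have h3 : |g z| = (1 / pi z) * (|g z| * pi z) := by
      field_simp [(S.pipos z).ne']
    rw [h3]
    exact mul_le_mul h2 h1 (hnn z) hQ0
  calc mass pi g univ ≤ ∑ z, (Q * L) * (|g z| * pi z) := by
        refine Finset.sum_le_sum fun z _ => ?_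
        rw [← sq_abs]
        nlinarith [mul_le_mul_of_nonneg_right (hb z) (hnn z)]
    _ = (Q * L) * ∑ z, |g z| * pi z := by rw [Finset.mul_sum]
    _ ≤ (Q * L) * L := by gcongr
    _ = _ := by ring

lemma en_univ_le (S : Sett G K pi θ CD CP Cc m) (g : V → ℝ) :
    en K pi g univ ≤ 4 * mass pi g univ := by
  have h1 : ∑ z, ∑ w, g z ^ 2 * JJ K pi z w = mass pi g univ := by
    unfold mass
    refine Finset.sum_congr rfl fun z _ => ?_
    rw [← Finset.mul_sum, S.jsum]
  have h2 := S.swap_sum (fun z w => g z ^ 2)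
  calc en K pi g univ ≤ ∑ z, ∑ w, (2 * (g z ^ 2 * JJ K pi z w) + 2 * (g w ^ 2 * JJ K pi z w)) := by
        refine Finset.sum_le_sum fun z _ => Finset.sum_le_sum fun w _ => ?_
        nlinarith [S.jnn z w, mul_nonneg (sq_nonneg (g z + g w)) (S.jnn z w)]
    _ = 2 * ∑ z, ∑ w, g z ^ 2 * JJ K pi z w + 2 * ∑ z, ∑ w, g w ^ 2 * JJ K pi z w := by
        simp only [Finset.sum_add_distrib, Finset.mul_sum]
    _ = _ := by rw [h2, h1]; ring

lemma step_ineq (S : Sett G K pi θ CD CP Cc m) (y : V) (g : V → ℝ) (CL R q δ : ℝ)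
    (hD : (1 : ℝ) ≤ gdiam G) (hCL : 0 < CL)
    (hg : ∀ z, z ≠ y → g z - ∑ w, K z w * g w = -1)
    (hL : ∑ z, |g z| * pi z ≤ CL * (gdiam G : ℝ) ^ θ)
    (hq0 : 0 < q) (hq1 : q < 1) (hδ : 0 < δ) (hδq : δ ≤ q - q ^ 2)
    (hR : 1 ≤ (1 - q) / 6 * R) (hRD : R ≤ gdiam G) :
    (R ^ θ * R ^ m) * en K pi g (extr G y R) ≤
      (4 * (Cc * CD ^ 5) / (1 + 4 * (Cc * CD ^ 5)) + CD ^ 5 * CP * (δ / ((1 - q) / 6)) ^ θ) *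
        ((R ^ θ * R ^ m) * en K pi g (extr G y (q ^ 2 * R))) +
      (CD ^ 5 * ((1 - q) / 6) ^ (-θ) * (2 / δ) ^ m * CL ^ 2 + 4 * CL) *
        ((gdiam G : ℝ) ^ m * ((gdiam G : ℝ) ^ θ) ^ 2) := by
  set D : ℝ := (gdiam G : ℝ) with hDdef
  set κ := (1 - q) / 6 with hκ
  have hκ0 : 0 < κ := by rw [hκ]; linarith
  have hR0 : 0 < R := by
    by_contra h; push Not at h
    nlinarith
  set c := 4 * (Cc * CD ^ 5) with hc
  have hCD := S.hCD
  have hCD0 : 0 < CD := by linarith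
  have hCP := S.hCP
  have hCc := S.hCc
  have hθ := S.hθ
  have hc0 : 0 < c := by rw [hc]; positivity
  have hole := S.hole y g (CL * D ^ θ) R (κ * R) hg hL hR (by rw [hκ]; nlinarith)
  have hqR : R - 6 * (κ * R) = q * R := by rw [hκ]; ring
  rw [hqR, ← hc] at hole
  have hq2 : q ^ 2 < 1 := by nlinarith
  have nash := S.nash g (extr G y (q * R)) (extr G y (q ^ 2 * R)) (r := δ * R) (by positivity)
    (by nlinarith [sq_nonneg q]) (by
      intro z hz w hw
      rw [mem_ext] at *
      rw [mem_gball] at hw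
      have := S.tri y w z
      rw [dsymm w z] at this
      nlinarith)
  set e0 := en K pi g (extr G y R) with he0
  set e1 := en K pi g (extr G y (q * R)) with he1
  set e2 := en K pi g (extr G y (q ^ 2 * R)) with he2
  set M := mass pi g (extr G y (q * R)) with hM
  have hM0 : 0 ≤ M := mass_nonneg S.pipos g _
  have he20 : 0 ≤ e2 := en_nonneg S.jnn g _
  have h12 : e1 ≤ e2 := en_mono S.jnn g (by
    intro z; rw [mem_ext, mem_ext]; intro h; nlinarith [mul_pos hq0 hR0])
  set ℓ := ∑ z, |g z| * pi z with hℓ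
  have hℓ0 : 0 ≤ ℓ := Finset.sum_nonneg fun z _ => mul_nonneg (abs_nonneg _) (S.pipos z).le
  have hDθ : 0 < D ^ θ := Real.rpow_pos_of_pos (by linarith) θ
  have hRθ : 0 < R ^ θ := Real.rpow_pos_of_pos hR0 θ
  have hκθ : 0 < κ ^ (-θ) := Real.rpow_pos_of_pos hκ0 _
  -- e0 bound
  have b1 : e0 ≤ c / (1 + c) * e2 + (κ * R) ^ (-θ) * M + 4 * (CL * D ^ θ) := by
    have hP : 0 ≤ (κ * R) ^ (-θ) * M := mul_nonneg (Real.rpow_nonneg (by positivity) _) hM0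
    have hQ : 0 ≤ 4 * (CL * D ^ θ) := by positivity
    set P := (κ * R) ^ (-θ) * M
    have h1c : (0:ℝ) < 1 + c := by linarith
    have : e0 ≤ (c * (e1 + P) + 4 * (CL * D ^ θ)) / (1 + c) := by
      rw [le_div_iff₀' h1c]; exact hole
    refine this.trans ?_
    rw [div_le_iff₀ h1c]
    have : (c / (1 + c) * e2 + P + 4 * (CL * D ^ θ)) * (1 + c) =
        c * e2 + P * (1 + c) + 4 * (CL * D ^ θ) * (1 + c) := by field_simp
    rw [this]
    nlinarith
  have hκR : (κ * R) ^ (-θ) = κ ^ (-θ) * (R ^ θ)⁻¹ := by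
    rw [Real.mul_rpow hκ0.le hR0.le, Real.rpow_neg hR0.le]
  have b2 : R ^ θ * ((κ * R) ^ (-θ) * M) ≤ CD ^ 5 * CP * (δ / κ) ^ θ * (R ^ θ * e2) +
      CD ^ 5 * κ ^ (-θ) * (2 * D / (δ * R)) ^ m * (CL * D ^ θ) ^ 2 := by
    have h1 : R ^ θ * ((κ * R) ^ (-θ) * M) = κ ^ (-θ) * M := by
      rw [hκR]; field_simp
    rw [h1]
    have h2 : κ ^ (-θ) * M ≤ κ ^ (-θ) * (CD ^ 5 * (CP * (δ * R) ^ θ * e2 +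
        (2 * D / (δ * R)) ^ m * (CL * D ^ θ) ^ 2)) := by
      refine mul_le_mul_of_nonneg_left (nash.trans ?_) hκθ.le
      gcongr
    refine h2.trans (le_of_eq ?_)
    rw [Real.mul_rpow hδ.le hR0.le, Real.div_rpow hδ.le hκ0.le, Real.rpow_neg hκ0.le]
    ring
  have b3 : R ^ m * (2 * D / (δ * R)) ^ m = (2 / δ) ^ m * D ^ m := by
    rw [← mul_pow, ← mul_pow]; congr 1; field_simp
  have b4 : R ^ θ * R ^ m * (4 * (CL * D ^ θ)) ≤ 4 * CL * (D ^ m * (D ^ θ) ^ 2) := by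
    have h1 : R ^ θ ≤ D ^ θ := Real.rpow_le_rpow hR0.le hRD (by linarith)
    have h2 : R ^ m ≤ D ^ m := by gcongr
    calc R ^ θ * R ^ m * (4 * (CL * D ^ θ)) ≤ D ^ θ * D ^ m * (4 * (CL * D ^ θ)) := by gcongr
      _ = _ := by ring
  have hRm : 0 < R ^ m := by positivity
  calc (R ^ θ * R ^ m) * e0
      ≤ (R ^ θ * R ^ m) * (c / (1 + c) * e2 + (κ * R) ^ (-θ) * M + 4 * (CL * D ^ θ)) := by gcongr
    _ = c / (1 + c) * (R ^ θ * R ^ m * e2) + R ^ m * (R ^ θ * ((κ * R) ^ (-θ) * M)) +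
          R ^ θ * R ^ m * (4 * (CL * D ^ θ)) := by ring
    _ ≤ c / (1 + c) * (R ^ θ * R ^ m * e2) + R ^ m * (CD ^ 5 * CP * (δ / κ) ^ θ * (R ^ θ * e2) +
          CD ^ 5 * κ ^ (-θ) * (2 * D / (δ * R)) ^ m * (CL * D ^ θ) ^ 2) +
          4 * CL * (D ^ m * (D ^ θ) ^ 2) := by gcongr
    _ = c / (1 + c) * (R ^ θ * R ^ m * e2) + CD ^ 5 * CP * (δ / κ) ^ θ * (R ^ θ * R ^ m * e2) +
          CD ^ 5 * κ ^ (-θ) * (R ^ m * (2 * D / (δ * R)) ^ m) * (CL * D ^ θ) ^ 2 +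
          4 * CL * (D ^ m * (D ^ θ) ^ 2) := by ring
    _ = _ := by rw [b3]; ring

end Sett

/-- uniform energy bound away from the pole -/
lemma energy_bound (θ CD CP Cc CL : ℝ) (m : ℕ) (hθ : 2 ≤ θ) (hCD : 1 ≤ CD) (hCP : 0 < CP)
    (hCc : 0 < Cc) (hCL : 0 < CL) :
    ∃ X : ℝ, 0 < X ∧ ∀ (V : Type) [Fintype V] [DecidableEq V]
      (G : SimpleGraph V) (K : V → V → ℝ) (pi : V → ℝ),
      Sett G K pi θ CD CP Cc m → (1 : ℝ) ≤ gdiam G → ∀ (y : V) (g : V → ℝ),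
      (∀ z, z ≠ y → g z - ∑ w, K z w * g w = -1) →
      (∑ z, |g z| * pi z ≤ CL * (gdiam G : ℝ) ^ θ) →
      ∀ R : ℝ, 0 < R → R ≤ gdiam G →
      (R ^ θ * R ^ m) * en K pi g (extr G y R) ≤
        X * ((gdiam G : ℝ) ^ m * ((gdiam G : ℝ) ^ θ) ^ 2) := by
  have hCD0 : 0 < CD := by linarith
  set c := 4 * (Cc * CD ^ 5) with hc
  have hc0 : 0 < c := by rw [hc]; positivity
  obtain ⟨q, δ, β, hq0, hq1, hδ0, hδq, hβ0, hβ1, hβ⟩ := consts_aux (c / (1 + c)) (CD ^ 5 * CP) θ m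
    (by positivity) (by rw [div_lt_one (by linarith)]; linarith) (by positivity) hθ
  set κ := (1 - q) / 6 with hκ
  have hκ0 : 0 < κ := by rw [hκ]; linarith
  set B := CD ^ 5 * κ ^ (-θ) * (2 / δ) ^ m * CL ^ 2 + 4 * CL with hB
  have hB0 : 0 < B := by positivity
  set X0 := (1 / κ) ^ θ * (1 / κ) ^ m * (4 * (4 ^ m * CL ^ 2)) with hX0
  have hX00 : 0 < X0 := by positivity
  set X := max X0 (B / (1 - β)) with hX
  have hXB : β * X + B ≤ X := by
    have h1 : B / (1 - β) ≤ X := le_max_right _ _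
    rw [div_le_iff₀ (by linarith)] at h1
    linarith
  refine ⟨X, lt_of_lt_of_le hX00 (le_max_left _ _), ?_⟩
  intro V _ _ G K pi S hD y g hg hL
  set D : ℝ := (gdiam G : ℝ) with hDdef
  have hDθ : 0 < D ^ θ := Real.rpow_pos_of_pos (by linarith) θ
  have hDm : 0 < D ^ m := by positivity
  have base : ∀ R : ℝ, 0 < R → κ * R < 1 →
      (R ^ θ * R ^ m) * en K pi g (extr G y R) ≤ X * (D ^ m * (D ^ θ) ^ 2) := by
    intro R hR hRκ
    have h1 : en K pi g (extr G y R) ≤ 4 * ((4 * D) ^ m * (CL * D ^ θ) ^ 2) :=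
      (en_mono S.jnn g (Finset.subset_univ _)).trans
        ((S.en_univ_le g).trans
          (mul_le_mul_of_nonneg_left (S.mass_univ_le hD g _ hL) (by norm_num)))
    have hR1 : R ≤ 1 / κ := by rw [le_div_iff₀ hκ0]; linarith
    have h2 : R ^ θ ≤ (1 / κ) ^ θ := Real.rpow_le_rpow hR.le hR1 (by linarith)
    have h3 : R ^ m ≤ (1 / κ) ^ m := by gcongr
    have h4 : 0 ≤ en K pi g (extr G y R) := en_nonneg S.jnn g _
    have h5 : 0 ≤ R ^ θ := Real.rpow_nonneg hR.le θ
    calc (R ^ θ * R ^ m) * en K pi g (extr G y R)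
        ≤ ((1 / κ) ^ θ * (1 / κ) ^ m) * (4 * ((4 * D) ^ m * (CL * D ^ θ) ^ 2)) := by gcongr
      _ = X0 * (D ^ m * (D ^ θ) ^ 2) := by rw [hX0, mul_pow, mul_pow]; ring
      _ ≤ _ := by gcongr; exact le_max_left _ _
  have hq2 : q ^ 2 < 1 := by nlinarith
  have main : ∀ n : ℕ, ∀ R : ℝ, 0 < R → R ≤ D → κ * (R * (q ^ 2) ^ n) < 1 →
      (R ^ θ * R ^ m) * en K pi g (extr G y R) ≤ X * (D ^ m * (D ^ θ) ^ 2) := by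
    intro n
    induction n with
    | zero =>
      intro R hR _ h
      exact base R hR (by simpa using h)
    | succ n ih =>
      intro R hR hRD h
      by_cases hs : κ * R < 1
      · exact base R hR hs
      push Not at hs
      have h1 := S.step_ineq y g CL R q δ hD hCL hg hL hq0 hq1 hδ0 hδq hs hRD
      have h2 := ih (q ^ 2 * R) (by positivity) (by nlinarith) (by
        rw [pow_succ] at h
        calc _ = κ * (R * ((q ^ 2) ^ n * q ^ 2)) := by ring
          _ < 1 := h)
      have he : 0 ≤ en K pi g (extr G y (q ^ 2 * R)) := en_nonneg S.jnn g _
      have hRθ : 0 < R ^ θ := Real.rpow_pos_of_pos hR θ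
      have hRm : 0 < R ^ m := by positivity
      rw [Real.mul_rpow (by positivity) hR.le, mul_pow] at h2
      refine h1.trans ?_
      calc _ ≤ (β * ((q ^ 2) ^ θ * (q ^ 2) ^ m)) *
            ((R ^ θ * R ^ m) * en K pi g (extr G y (q ^ 2 * R))) + B * (D ^ m * (D ^ θ) ^ 2) := by
            refine add_le_add (mul_le_mul_of_nonneg_right hβ (by positivity)) le_rfl
        _ = β * ((q ^ 2) ^ θ * R ^ θ * ((q ^ 2) ^ m * R ^ m) *
              en K pi g (extr G y (q ^ 2 * R))) + B * (D ^ m * (D ^ θ) ^ 2) := by ring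
        _ ≤ β * (X * (D ^ m * (D ^ θ) ^ 2)) + B * (D ^ m * (D ^ θ) ^ 2) := by
            gcongr
        _ = (β * X + B) * (D ^ m * (D ^ θ) ^ 2) := by ring
        _ ≤ _ := by gcongr
  intro R hR hRD
  obtain ⟨n, hn⟩ := exists_pow_lt_of_lt_one (show (0 : ℝ) < 1 / (κ * R) by positivity) hq2
  refine main n R hR hRD ?_
  rw [lt_div_iff₀ (by positivity)] at hn
  linarith

/-- decay of a sequence satisfying a Nash type inequality -/
lemma nash_decay (a : ℕ → ℝ) (A B D θ : ℝ) (m : ℕ) (hA : 0 < A) (hB : 0 < B) (hD : 0 < D)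
    (hθ : 2 ≤ θ) (hm : 1 ≤ m) (hpos : ∀ n, 0 < a n) (hanti : ∀ n, a (n + 1) ≤ a n)
    (hN : ∀ n, ∀ r : ℝ, 0 < r → r ≤ D → a n ≤ A * r ^ θ * (a n - a (n + 1)) + B * (D / r) ^ m)
    (T : ℕ) (hT : 2 * A * m / θ * D ^ θ < T) : a T ≤ 2 * B := by
  by_contra hcon
  push Not at hcon
  have han : Antitone a := antitone_nat_of_succ_le hanti
  have hm0 : (0 : ℝ) < m := by exact_mod_cast hm
  set s : ℝ := θ / m with hs
  have hs0 : 0 < s := by positivity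
  have hDθ : 0 < D ^ θ := Real.rpow_pos_of_pos hD θ
  set b : ℕ → ℝ := fun n => (a n / (2 * B)) ^ (-s) with hb
  have hbpos : ∀ n, 0 < b n := fun n => Real.rpow_pos_of_pos (div_pos (hpos n) (by linarith)) _
  have hstep : ∀ n, n < T → b n + s / (2 * A * D ^ θ) ≤ b (n + 1) := by
    intro n hn
    have hge : 2 * B < a n := lt_of_lt_of_le hcon (han hn.le)
    have hx1 : 1 ≤ a n / (2 * B) := by rw [le_div_iff₀ (by linarith)]; linarith
    have hx0 : 0 < a n / (2 * B) := by linarith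
    -- choose r
    set r := D * (a n / (2 * B)) ^ (-(1 / (m : ℝ))) with hr
    have hp0 : 0 < (a n / (2 * B)) ^ (-(1 / (m : ℝ))) := Real.rpow_pos_of_pos hx0 _
    have hr0 : 0 < r := by positivity
    have hrD : r ≤ D := by
      have : (a n / (2 * B)) ^ (-(1 / (m : ℝ))) ≤ 1 :=
        Real.rpow_le_one_of_one_le_of_nonpos hx1 (by simp)
      rw [hr]; nlinarith
    have h1 := hN n r hr0 hrD
    have h2 : (D / r) ^ m = a n / (2 * B) := by
      rw [hr, Real.rpow_neg hx0.le]
      have : D / (D * ((a n / (2 * B)) ^ (1 / (m : ℝ)))⁻¹) = (a n / (2 * B)) ^ (1 / (m : ℝ)) := by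
        have := (Real.rpow_pos_of_pos hx0 (1 / (m : ℝ))).ne'
        field_simp
      rw [this, ← Real.rpow_natCast, ← Real.rpow_mul hx0.le]
      rw [one_div_mul_cancel hm0.ne', Real.rpow_one]
    have h3 : r ^ θ = D ^ θ * b n := by
      rw [hr, Real.mul_rpow hD.le hp0.le, ← Real.rpow_mul hx0.le]
      simp only [hb]
      congr 2
      rw [hs]; ring
    rw [h2, h3] at h1
    have h4 : B * (a n / (2 * B)) = a n / 2 := by field_simp
    rw [h4] at h1
    -- convexity
    have hy0 : 0 < a (n + 1) / a n := div_pos (hpos _) (hpos _)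
    have h5 : b (n + 1) = b n * (a (n + 1) / a n) ^ (-s) := by
      simp only [hb]
      rw [← Real.mul_rpow hx0.le hy0.le]
      congr 1
      have := (hpos n).ne'
      field_simp
    have h6 : 1 + s * (1 - a (n + 1) / a n) ≤ (a (n + 1) / a n) ^ (-s) := by
      rw [Real.rpow_def_of_pos hy0]
      have e1 := Real.add_one_le_exp (Real.log (a (n + 1) / a n) * -s)
      have e2 := Real.log_le_sub_one_of_pos hy0
      nlinarith
    rw [h5]
    have h7 : 1 / (2 * A * D ^ θ) ≤ b n * (1 - a (n + 1) / a n) := by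
      rw [div_le_iff₀ (by positivity)]
      have h8 : a n * (b n * (1 - a (n + 1) / a n)) = b n * (a n - a (n + 1)) := by
        have := (hpos n).ne'
        field_simp
      have h9 : a n * 1 ≤ a n * (b n * (1 - a (n + 1) / a n) * (2 * A * D ^ θ)) := by
        calc a n * 1 ≤ 2 * (A * (D ^ θ * b n) * (a n - a (n + 1))) := by linarith
          _ = (b n * (a n - a (n + 1))) * (2 * A * D ^ θ) := by ring
          _ = _ := by rw [← h8]; ring
      exact le_of_mul_le_mul_left h9 (hpos n)
    calc b n + s / (2 * A * D ^ θ) = b n + s * (1 / (2 * A * D ^ θ)) := by ring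
      _ ≤ b n + s * (b n * (1 - a (n + 1) / a n)) := by gcongr
      _ = b n * (1 + s * (1 - a (n + 1) / a n)) := by ring
      _ ≤ _ := mul_le_mul_of_nonneg_left h6 (hbpos n).le
  have hsum : ∀ n, n ≤ T → n * (s / (2 * A * D ^ θ)) < b n := by
    intro n
    induction n with
    | zero => intro _; simpa using hbpos 0
    | succ n ih =>
      intro hn
      have := ih (by omega)
      have := hstep n (by omega)
      push_cast
      linarith
  have h1 := hsum T le_rfl
  have h2 : b T ≤ 1 := by
    refine Real.rpow_le_one_of_one_le_of_nonpos ?_ (by linarith)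
    rw [le_div_iff₀ (by linarith)]; linarith
  have h3 : 1 < T * (s / (2 * A * D ^ θ)) := by
    have h4 : 0 < s / (2 * A * D ^ θ) := by positivity
    have h5 := mul_lt_mul_of_pos_right hT h4
    have h6 : 2 * A * m / θ * D ^ θ * (s / (2 * A * D ^ θ)) = 1 := by
      rw [hs]; field_simp
    linarith
  linarith

namespace Sett

variable {G : SimpleGraph V} {K : V → V → ℝ} {pi : V → ℝ} {θ CD CP Cc : ℝ} {m : ℕ}

/-- one step L² contraction for lazy kernels -/
lemma contract (S : Sett G K pi θ CD CP Cc m) (f : V → ℝ) :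
    mass pi (fun z => ∑ w, K z w * f w) univ + en K pi f univ / 2 ≤ mass pi f univ := by
  have hpt : ∀ z, (∑ w, K z w * f w) ^ 2 + (∑ w, K z w * (f z - f w) ^ 2) / 2 ≤
      ∑ w, K z w * f w ^ 2 := by
    intro z
    set c := f z with hc
    set a1 := ∑ w, K z w * (f w - c) with ha1
    set a2 := ∑ w, K z w * (f w - c) ^ 2 with ha2
    have e1 : ∑ w, K z w * f w = a1 + c := by
      have : a1 = ∑ w, K z w * f w - (∑ w, K z w) * c := by
        rw [ha1, Finset.sum_mul, ← Finset.sum_sub_distrib]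
        exact Finset.sum_congr rfl fun w _ => by ring
      rw [this, S.ksum]; ring
    have e2 : ∑ w, K z w * f w ^ 2 = a2 + 2 * c * a1 + c ^ 2 := by
      have : a2 + 2 * c * a1 + (∑ w, K z w) * c ^ 2 = ∑ w, K z w * f w ^ 2 := by
        rw [ha1, ha2, Finset.sum_mul, Finset.mul_sum, ← Finset.sum_add_distrib,
          ← Finset.sum_add_distrib]
        exact Finset.sum_congr rfl fun w _ => by ring
      rw [← this, S.ksum]; ring
    have e3 : ∑ w, K z w * (c - f w) ^ 2 = a2 :=
      Finset.sum_congr rfl fun w _ => by ring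
    have e4 : a1 ^ 2 ≤ a2 / 2 := by
      have f1 : a1 = ∑ w ∈ univ.erase z, K z w * (f w - c) := by
        rw [ha1, ← Finset.add_sum_erase univ _ (Finset.mem_univ z)]
        simp [hc]
      have f2 : a2 = ∑ w ∈ univ.erase z, K z w * (f w - c) ^ 2 := by
        rw [ha2, ← Finset.add_sum_erase univ _ (Finset.mem_univ z)]
        simp [hc]
      have f3 : ∑ w ∈ univ.erase z, K z w ≤ 1 / 2 := by
        have := Finset.add_sum_erase univ (fun w => K z w) (Finset.mem_univ z)
        rw [S.ksum] at this
        linarith [S.lazy z]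
      have f4 := Finset.sum_sq_le_sum_mul_sum_of_sq_eq_mul (univ.erase z)
        (r := fun w => K z w * (f w - c)) (f := fun w => K z w)
        (g := fun w => K z w * (f w - c) ^ 2) (fun w _ => S.knn z w)
        (fun w _ => mul_nonneg (S.knn z w) (sq_nonneg _)) (fun w _ => by ring)
      rw [← f1, ← f2] at f4
      have f5 : 0 ≤ a2 := Finset.sum_nonneg fun w _ => mul_nonneg (S.knn z w) (sq_nonneg _)
      nlinarith
    rw [e1, e2, e3]
    nlinarith
  have h1 : ∑ z, (∑ w, K z w * f w ^ 2) * pi z = mass pi f univ := by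
    have h := S.swap_sum (fun z w => f z ^ 2)
    have h2 : ∑ z, ∑ w, f z ^ 2 * JJ K pi z w = mass pi f univ := by
      unfold mass
      refine Finset.sum_congr rfl fun z _ => ?_
      rw [← Finset.mul_sum, S.jsum]
    rw [← h2, ← h]
    refine Finset.sum_congr rfl fun z _ => ?_
    rw [Finset.sum_mul]
    refine Finset.sum_congr rfl fun w _ => ?_
    unfold JJ; ring
  have h3 : en K pi f univ / 2 = ∑ z, (∑ w, K z w * (f z - f w) ^ 2) / 2 * pi z := by
    unfold en
    rw [Finset.sum_div]
    refine Finset.sum_congr rfl fun z _ => ?_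
    rw [Finset.sum_div, Finset.sum_div, Finset.sum_mul]
    refine Finset.sum_congr rfl fun w _ => ?_
    unfold JJ; ring
  rw [← h1, h3]
  unfold mass
  rw [← Finset.sum_add_distrib]
  refine Finset.sum_le_sum fun z _ => ?_
  rw [← add_mul]
  exact mul_le_mul_of_nonneg_right (hpt z) (S.pipos z).le

lemma knorm_succ (n : ℕ) (x y : V) :
    knorm K pi (n + 1) x y = ∑ w, K x w * knorm K pi n w y := by
  unfold knorm
  simp only [matpow]
  rw [Finset.sum_div]
  exact Finset.sum_congr rfl fun w _ => by ring

lemma mean_K (S : Sett G K pi θ CD CP Cc m) (f : V → ℝ) :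
    ∑ z, (∑ w, K z w * f w) * pi z = ∑ z, f z * pi z := by
  have h := S.swap_sum (fun z w => f z)
  have h2 : ∑ z, ∑ w, f z * JJ K pi z w = ∑ z, f z * pi z := by
    refine Finset.sum_congr rfl fun z _ => ?_
    rw [← Finset.mul_sum, S.jsum]
  rw [← h2, ← h]
  refine Finset.sum_congr rfl fun z _ => ?_
  rw [Finset.sum_mul]
  refine Finset.sum_congr rfl fun w _ => ?_
  unfold JJ; ring

lemma knorm_nonneg (S : Sett G K pi θ CD CP Cc m) (n : ℕ) (x y : V) :
    0 ≤ knorm K pi n x y := by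
  induction n generalizing x with
  | zero =>
    unfold knorm
    simp only [matpow]
    refine div_nonneg ?_ (S.pipos y).le
    split_ifs <;> norm_num
  | succ n ih =>
    rw [knorm_succ]
    exact Finset.sum_nonneg fun w _ => mul_nonneg (S.knn _ _) (ih w)

lemma knorm_mean (S : Sett G K pi θ CD CP Cc m) (n : ℕ) (y : V) :
    ∑ z, knorm K pi n z y * pi z = 1 := by
  induction n with
  | zero =>
    unfold knorm
    simp only [matpow]
    rw [Finset.sum_eq_single y]
    · simp [(S.pipos y).ne']
    · intro b _ hb; simp [hb]
    · simp
  | succ n ih =>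
    rw [← ih, ← S.mean_K (fun z => knorm K pi n z y)]
    exact Finset.sum_congr rfl fun z _ => by rw [knorm_succ]

lemma poincare (S : Sett G K pi θ CD CP Cc m) (hD : (1 : ℝ) ≤ gdiam G) (y : V) (f : V → ℝ)
    (hf : ∑ z, f z * pi z = 0) :
    mass pi f univ ≤ CP * (gdiam G : ℝ) ^ θ * en K pi f univ := by
  have h := S.pI y (gdiam G) (by linarith) f
  rw [gball_univ y le_rfl, hf] at h
  simpa using h

/-- L¹ bound of the heat kernel deviations -/
lemma l1_le (S : Sett G K pi θ CD CP Cc m) (f : V → ℝ) :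
    (∑ z, |f z| * pi z) ^ 2 ≤ mass pi f univ := by
  have f4 := Finset.sum_sq_le_sum_mul_sum_of_sq_eq_mul univ
        (r := fun w => |f w| * pi w) (f := fun w => pi w)
        (g := fun w => f w ^ 2 * pi w) (fun w _ => (S.pipos w).le)
        (fun w _ => mul_nonneg (sq_nonneg _) (S.pipos w).le)
        (fun w _ => by rw [mul_pow, sq_abs]; ring)
  rw [S.pisum, one_mul] at f4
  exact f4

lemma knorm_mass_le (S : Sett G K pi θ CD CP Cc m) (hD : (1 : ℝ) ≤ gdiam G) (y : V) (T : ℕ)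
    (hT : 2 * (2 * CD ^ 5 * CP) * m / θ * (gdiam G : ℝ) ^ θ < T) :
    mass pi (fun z => knorm K pi T z y) univ ≤ 2 * (CD ^ 5 * 2 ^ m) := by
  have hCD := S.hCD
  have hCP := S.hCP
  have hCD0 : 0 < CD := by linarith
  have hstep : ∀ n, mass pi (fun z => knorm K pi (n + 1) z y) univ +
      en K pi (fun z => knorm K pi n z y) univ / 2 ≤ mass pi (fun z => knorm K pi n z y) univ := by
    intro n
    have := S.contract (fun z => knorm K pi n z y)
    simpa only [← knorm_succ] using this
  have habs : ∀ n, ∑ z, |knorm K pi n z y| * pi z = 1 := by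
    intro n
    rw [← S.knorm_mean n y]
    exact Finset.sum_congr rfl fun z _ => by rw [abs_of_nonneg (S.knorm_nonneg n z y)]
  refine nash_decay (fun n => mass pi (fun z => knorm K pi n z y) univ) (2 * CD ^ 5 * CP)
    (CD ^ 5 * 2 ^ m) (gdiam G) θ m (by positivity) (by positivity) (by linarith) S.hθ S.hm
    ?_ ?_ ?_ T hT
  · intro n
    have := S.l1_le (fun z => knorm K pi n z y)
    simp only [habs] at this
    linarith
  · intro n
    have := hstep n
    have := en_nonneg S.jnn (fun z => knorm K pi n z y) univ
    linarith
  · intro n r hr hrD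
    have h1 := S.nash (fun z => knorm K pi n z y) univ univ hr hrD (fun z _ => Finset.subset_univ _)
    rw [habs] at h1
    have h2 := hstep n
    have hrθ : 0 ≤ r ^ θ := Real.rpow_nonneg hr.le θ
    set e := en K pi (fun z => knorm K pi n z y) univ
    set a0 := mass pi (fun z => knorm K pi n z y) univ
    set a1 := mass pi (fun z => knorm K pi (n + 1) z y) univ
    calc a0 ≤ CD ^ 5 * (CP * r ^ θ * e + (2 * (gdiam G : ℝ) / r) ^ m * 1 ^ 2) := h1
      _ ≤ CD ^ 5 * (CP * r ^ θ * (2 * (a0 - a1)) + (2 * (gdiam G : ℝ) / r) ^ m * 1 ^ 2) := by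
          gcongr; linarith
      _ = _ := by rw [mul_div_assoc, mul_pow]; ring

lemma sum_decay (q p : ℕ → ℝ) (k P : ℝ) (T : ℕ) (hk : 0 < k) (hq0 : ∀ n, 0 ≤ q n)
    (hq2 : ∀ n, q n ≤ 2) (hqp : ∀ n, q n ^ 2 ≤ p n) (hp : ∀ n, p n ≤ k * (p n - p (n + 1)))
    (hP : 1 ≤ P) (hT : p T ≤ P) :
    Summable q ∧ ∑' n, q n ≤ 2 * T + 2 * k * P := by
  have hp0 : ∀ n, 0 ≤ p n := fun n => (sq_nonneg _).trans (hqp n)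
  set s : ℕ → ℝ := fun n => Real.sqrt (p n) with hs
  have hs0 : ∀ n, 0 ≤ s n := fun n => Real.sqrt_nonneg _
  have hsq : ∀ n, s n ^ 2 = p n := fun n => Real.sq_sqrt (hp0 n)
  have hqs : ∀ n, q n ≤ s n := fun n => Real.le_sqrt_of_sq_le (hqp n)
  have hanti : ∀ n, s (n + 1) ≤ s n := by
    intro n
    refine Real.sqrt_le_sqrt ?_
    by_contra h
    push Not at h
    have := hp n
    have := hp0 n
    nlinarith
  have hstep : ∀ n, s n ≤ 2 * k * (s n - s (n + 1)) := by
    intro n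
    rcases (hs0 n).eq_or_lt with h | h
    · have := hanti n
      have := hs0 (n + 1)
      have h2 : s (n + 1) = 0 := by linarith
      rw [h2, ← h]; simp
    · have h1 := hp n
      rw [← hsq n, ← hsq (n + 1)] at h1
      have h2 : s n * s n ≤ s n * (2 * k * (s n - s (n + 1))) := by
        have h3 : 0 ≤ k * (s n - s (n + 1)) * (s n - s (n + 1)) :=
          mul_nonneg (mul_nonneg hk.le (by linarith [hanti n])) (by linarith [hanti n])
        nlinarith
      exact le_of_mul_le_mul_left h2 h
  have htel : ∀ N, ∑ i ∈ range N, q (T + i) ≤ 2 * k * (s T - s (T + N)) := by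
    intro N
    induction N with
    | zero => simp
    | succ N ih =>
      rw [Finset.sum_range_succ]
      have h1 := hqs (T + N)
      have h2 := hstep (T + N)
      rw [← add_assoc]
      nlinarith
  have hsT : s T ≤ P := by
    refine (Real.sqrt_le_sqrt hT).trans ?_
    rw [Real.sqrt_le_left (by linarith)]
    nlinarith
  have hpart : ∀ N, ∑ i ∈ range N, q i ≤ 2 * T + 2 * k * P := by
    intro N
    have h1 : ∑ i ∈ range N, q i ≤ ∑ i ∈ range (T + N), q i :=
      Finset.sum_le_sum_of_subset_of_nonneg (Finset.range_mono (by omega)) fun i _ _ => hq0 i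
    rw [Finset.sum_range_add] at h1
    have h2 : ∑ i ∈ range T, q i ≤ 2 * T := by
      have := Finset.sum_le_card_nsmul (range T) q 2 fun i _ => hq2 i
      simpa [mul_comm] using this
    have h3 := htel N
    have h4 : 2 * k * (s T - s (T + N)) ≤ 2 * k * P :=
      mul_le_mul_of_nonneg_left (by linarith [hs0 (T + N)]) (by linarith)
    linarith
  exact ⟨summable_of_sum_range_le hq0 hpart, Real.tsum_le_of_sum_range_le hq0 hpart⟩

lemma dev_sum (S : Sett G K pi θ CD CP Cc m) (hD : (1 : ℝ) ≤ gdiam G) (y : V) :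
    Summable (fun n => ∑ z, |knorm K pi n z y - 1| * pi z) ∧
    ∑' n, ∑ z, |knorm K pi n z y - 1| * pi z ≤
      (2 * (2 * (2 * CD ^ 5 * CP) * m / θ + 1) +
        4 * CP * (2 * (CD ^ 5 * 2 ^ m))) * (gdiam G : ℝ) ^ θ := by
  have hCD := S.hCD
  have hCP := S.hCP
  have hθ := S.hθ
  have hD0 : (0 : ℝ) < gdiam G := by linarith
  have hDθ : (1 : ℝ) ≤ (gdiam G : ℝ) ^ θ := Real.one_le_rpow hD (by linarith)
  set c := 2 * (2 * CD ^ 5 * CP) * m / θ with hc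
  have hc0 : 0 ≤ c := by positivity
  set T := ⌊c * (gdiam G : ℝ) ^ θ⌋₊ + 1 with hT
  have hT1 : c * (gdiam G : ℝ) ^ θ < T := by
    rw [hT]; push_cast; exact Nat.lt_floor_add_one _
  have hT2 : (T : ℝ) ≤ (c + 1) * (gdiam G : ℝ) ^ θ := by
    rw [hT]; push_cast
    have := Nat.floor_le (a := c * (gdiam G : ℝ) ^ θ) (by positivity)
    linarith
  have hmass := S.knorm_mass_le hD y T hT1
  have hmean : ∀ n, ∑ z, (knorm K pi n z y - 1) * pi z = 0 := by
    intro n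
    have h : ∑ z, (knorm K pi n z y - 1) * pi z = ∑ z, knorm K pi n z y * pi z - ∑ z, pi z := by
      rw [← Finset.sum_sub_distrib]
      exact Finset.sum_congr rfl fun z _ => by ring
    rw [h, S.knorm_mean, S.pisum, sub_self]
  have hP : 1 ≤ 2 * (CD ^ 5 * 2 ^ m) := by
    have h1 : (1 : ℝ) ≤ CD ^ 5 := one_le_pow₀ hCD
    have h2 : (1 : ℝ) ≤ 2 ^ m := one_le_pow₀ (by norm_num)
    nlinarith
  have key := sum_decay (fun n => ∑ z, |knorm K pi n z y - 1| * pi z)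
    (fun n => mass pi (fun z => knorm K pi n z y - 1) univ) (2 * CP * (gdiam G : ℝ) ^ θ)
    (2 * (CD ^ 5 * 2 ^ m)) T (by positivity)
    (fun n => Finset.sum_nonneg fun z _ => mul_nonneg (abs_nonneg _) (S.pipos z).le)
    ?_ (fun n => S.l1_le _) ?_ hP ?_
  · refine ⟨key.1, key.2.trans ?_⟩
    nlinarith
  · intro n
    have h : ∑ z, |knorm K pi n z y - 1| * pi z ≤ ∑ z, (knorm K pi n z y * pi z + pi z) := by
      refine Finset.sum_le_sum fun z _ => ?_
      have h1 : |knorm K pi n z y - 1| ≤ knorm K pi n z y + 1 := by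
        have := S.knorm_nonneg n z y
        rw [abs_le]; constructor <;> linarith
      have := mul_le_mul_of_nonneg_right h1 (S.pipos z).le
      linarith
    rw [Finset.sum_add_distrib, S.knorm_mean, S.pisum] at h
    linarith
  · intro n
    have h1 := S.contract (fun z => knorm K pi n z y - 1)
    have h2 : ∀ z, ∑ w, K z w * (knorm K pi n w y - 1) = knorm K pi (n + 1) z y - 1 := by
      intro z
      rw [knorm_succ]
      conv_rhs => rw [← S.ksum z]
      rw [← Finset.sum_sub_distrib]
      exact Finset.sum_congr rfl fun w _ => by ring
    simp only [h2] at h1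
    have h3 := S.poincare hD y _ (hmean n)
    have h4 : 0 ≤ CP * (gdiam G : ℝ) ^ θ := by positivity
    nlinarith
  · refine le_trans ?_ hmass
    have h : mass pi (fun z => knorm K pi T z y - 1) univ =
        mass pi (fun z => knorm K pi T z y) univ - 2 * ∑ z, knorm K pi T z y * pi z + ∑ z, pi z := by
      unfold mass
      rw [Finset.mul_sum, ← Finset.sum_sub_distrib, ← Finset.sum_add_distrib]
      exact Finset.sum_congr rfl fun z _ => by ring
    rw [h, S.knorm_mean, S.pisum]
    linarith

end Sett

namespace Sett

variable {G : SimpleGraph V} {K : V → V → ℝ} {pi : V → ℝ} {θ CD CP Cc : ℝ} {m : ℕ}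

lemma knorm_summable (S : Sett G K pi θ CD CP Cc m) (hD : (1 : ℝ) ≤ gdiam G) (y z : V) :
    Summable (fun n => |knorm K pi n z y - 1| * pi z) := by
  refine Summable.of_nonneg_of_le (fun n => mul_nonneg (abs_nonneg _) (S.pipos z).le) (fun n => ?_)
    (S.dev_sum hD y).1
  exact Finset.single_le_sum (f := fun z => |knorm K pi n z y - 1| * pi z)
    (fun z _ => mul_nonneg (abs_nonneg _) (S.pipos z).le) (Finset.mem_univ z)

lemma knorm_summable_abs (S : Sett G K pi θ CD CP Cc m) (hD : (1 : ℝ) ≤ gdiam G) (y z : V) :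
    Summable (fun n => |knorm K pi n z y - 1|) :=
  (summable_mul_right_iff (S.pipos z).ne').1 (S.knorm_summable hD y z)

lemma green_l1 (S : Sett G K pi θ CD CP Cc m) (hD : (1 : ℝ) ≤ gdiam G) (y : V) :
    ∑ z, |green K pi z y| * pi z ≤ (2 * (2 * (2 * CD ^ 5 * CP) * m / θ + 1) +
        4 * CP * (2 * (CD ^ 5 * 2 ^ m))) * (gdiam G : ℝ) ^ θ := by
  refine le_trans ?_ (S.dev_sum hD y).2
  rw [Summable.tsum_finsetSum (fun z _ => S.knorm_summable hD y z)]
  refine Finset.sum_le_sum fun z _ => ?_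
  rw [tsum_mul_right]
  refine mul_le_mul_of_nonneg_right ?_ (S.pipos z).le
  have h := norm_tsum_le_tsum_norm (f := fun n => knorm K pi n z y - 1)
    (by simpa only [Real.norm_eq_abs] using S.knorm_summable_abs hD y z)
  unfold green
  simpa only [Real.norm_eq_abs] using h

lemma green_eq (S : Sett G K pi θ CD CP Cc m) (hD : (1 : ℝ) ≤ gdiam G) (y z : V) :
    green K pi z y - ∑ w, K z w * green K pi w y = (if z = y then 1 / pi y else 0) - 1 := by
  have hs : ∀ z, Summable (fun n => knorm K pi n z y - 1) :=
    fun z => (S.knorm_summable_abs hD y z).of_abs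
  have h1 : ∑ w, K z w * green K pi w y = ∑' n, (knorm K pi (n + 1) z y - 1) := by
    unfold green
    simp only [← tsum_mul_left]
    rw [← Summable.tsum_finsetSum (fun w _ => (hs w).mul_left _)]
    refine tsum_congr fun n => ?_
    rw [knorm_succ]
    conv_rhs => rw [← S.ksum z]
    rw [← Finset.sum_sub_distrib]
    exact Finset.sum_congr rfl fun w _ => by ring
  have h2 : green K pi z y = (knorm K pi 0 z y - 1) + ∑' n, (knorm K pi (n + 1) z y - 1) :=
    (hs z).tsum_eq_zero_add
  rw [h1, h2]
  have h3 : knorm K pi 0 z y = if z = y then 1 / pi y else 0 := by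
    unfold knorm
    simp only [matpow]
    split_ifs <;> simp
  rw [h3]; ring

lemma green_zero (S : Sett G K pi θ CD CP Cc m) (hD : gdiam G = 0) (x y : V) :
    green K pi x y = 0 := by
  have hsub : ∀ z, z = x := by
    intro z
    have h := dist_le_diam G x z
    rw [hD] at h
    have h2 : G.dist x z = 0 := by
      have : G.dist x z ≤ 0 := by exact_mod_cast h
      omega
    exact ((S.conn.dist_eq_zero_iff).1 h2).symm
  have hpi : pi x = 1 := by
    have := S.pisum
    rwa [Finset.sum_eq_single x (fun b _ hb => absurd (hsub b) hb) (by simp)] at this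
  unfold green
  have h : ∀ n, knorm K pi n x y - 1 = 0 := by
    intro n
    have := S.knorm_mean n y
    rw [Finset.sum_eq_single x (fun b _ hb => absurd (hsub b) hb) (by simp), hpi] at this
    linarith
  simp [h]

/-- Green's second identity with a cutoff -/
lemma green_id (S : Sett G K pi θ CD CP Cc m) (u v φ : V → ℝ) :
    ∑ z, ∑ w, (φ z - φ w) * (v z * u w - u z * v w) * JJ K pi z w =
      2 * (∑ z, φ z * u z * (v z - ∑ w, K z w * v w) * pi z -
        ∑ z, φ z * v z * (u z - ∑ w, K z w * u w) * pi z) := by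
  have e1 := S.ibp v (fun z => φ z * u z)
  have e2 := S.ibp u (fun z => φ z * v z)
  rw [mul_sub, ← e1, ← e2, ← Finset.sum_sub_distrib]
  refine Finset.sum_congr rfl fun z _ => ?_
  rw [← Finset.sum_sub_distrib]
  refine Finset.sum_congr rfl fun w _ => ?_
  ring

lemma cross_alg (a p q r s : ℝ) :
    |a * (p * s - q * r)| ≤ (p ^ 2 * a ^ 2 + (q - s) ^ 2 + (q ^ 2 * a ^ 2 + (p - r) ^ 2)) / 2 := by
  rw [abs_le]
  constructor <;>
  nlinarith [sq_nonneg (p * a - (q - s)), sq_nonneg (p * a + (q - s)),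
    sq_nonneg (q * a - (p - r)), sq_nonneg (q * a + (p - r))]

lemma cross_bound (S : Sett G K pi θ CD CP Cc m) (u v φ : V → ℝ) (A : Finset V)
    (hφ : ∀ z w, JJ K pi z w ≠ 0 → φ z ≠ φ w → z ∈ A ∧ w ∈ A) :
    |∑ z, ∑ w, (φ z - φ w) * (v z * u w - u z * v w) * JJ K pi z w| ≤
      (∑ z, ∑ w, u z ^ 2 * (φ z - φ w) ^ 2 * JJ K pi z w + en K pi u A +
       (∑ z, ∑ w, v z ^ 2 * (φ z - φ w) ^ 2 * JJ K pi z w + en K pi v A)) / 2 := by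
  have hen : ∀ f : V → ℝ, en K pi f A =
      ∑ z, ∑ w, (if z ∈ A ∧ w ∈ A then (f z - f w) ^ 2 * JJ K pi z w else 0) := by
    intro f
    unfold en
    rw [← Finset.sum_filter_add_sum_filter_not univ (fun z => z ∈ A)]
    rw [Finset.sum_eq_zero (s := univ.filter fun z => ¬ z ∈ A), add_zero]
    · rw [Finset.filter_mem_eq_inter, Finset.univ_inter]
      refine Finset.sum_congr rfl fun z hz => ?_
      simp only [hz, true_and]
      rw [← Finset.sum_filter, Finset.filter_mem_eq_inter, Finset.univ_inter]
    · intro z hz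
      rw [Finset.mem_filter] at hz
      exact Finset.sum_eq_zero fun w _ => by simp [hz.2]
  rw [hen u, hen v, ← Finset.sum_add_distrib, ← Finset.sum_add_distrib, ← Finset.sum_add_distrib,
    Finset.sum_div]
  refine (Finset.abs_sum_le_sum_abs _ _).trans (Finset.sum_le_sum fun z _ => ?_)
  rw [← Finset.sum_add_distrib, ← Finset.sum_add_distrib, ← Finset.sum_add_distrib,
    Finset.sum_div]
  refine (Finset.abs_sum_le_sum_abs _ _).trans (Finset.sum_le_sum fun w _ => ?_)
  have hJ := S.jnn z w
  by_cases h1 : JJ K pi z w = 0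
  · simp [h1]
  by_cases h2 : φ z = φ w
  · rw [h2]
    simp only [sub_self, zero_mul, abs_zero]
    have : ∀ f : V → ℝ,
        0 ≤ (if z ∈ A ∧ w ∈ A then (f z - f w) ^ 2 * JJ K pi z w else 0) := by
      intro f
      split_ifs
      · exact mul_nonneg (sq_nonneg _) hJ
      · exact le_rfl
    have a1 := this u
    have a2 := this v
    have : (0 : ℝ) ^ 2 = 0 := by norm_num
    rw [this]
    simp only [mul_zero, zero_mul, zero_add]
    linarith
  · rw [if_pos (hφ z w h1 h2), if_pos (hφ z w h1 h2), abs_mul, abs_of_nonneg hJ]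
    have := mul_le_mul_of_nonneg_right (cross_alg (φ z - φ w) (v z) (u z) (v w) (u w)) hJ
    refine this.trans (le_of_eq ?_)
    ring

end Sett

namespace Sett

variable {G : SimpleGraph V} {K : V → V → ℝ} {pi : V → ℝ} {θ CD CP Cc : ℝ} {m : ℕ}

lemma far_mass (S : Sett G K pi θ CD CP Cc m) (hD : (1 : ℝ) ≤ gdiam G) (p : V) (f : V → ℝ)
    (t E0 CL : ℝ) (ht : 0 < t) (ht1 : t ≤ 1)
    (hE : en K pi f (extr G p (t * gdiam G)) ≤ E0 * (gdiam G : ℝ) ^ θ)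
    (hL : ∑ z, |f z| * pi z ≤ CL * (gdiam G : ℝ) ^ θ) :
    mass pi f (extr G p (2 * t * gdiam G)) ≤
      CD ^ 5 * (CP * t ^ θ * E0 + (2 / t) ^ m * CL ^ 2) * ((gdiam G : ℝ) ^ θ) ^ 2 := by
  have hCD := S.hCD
  have hCP := S.hCP
  set D : ℝ := (gdiam G : ℝ) with hDd
  have hD0 : 0 < D := by linarith
  have hL0 : 0 ≤ ∑ z, |f z| * pi z :=
    Finset.sum_nonneg fun z _ => mul_nonneg (abs_nonneg _) (S.pipos z).le
  have h := S.nash f (extr G p (2 * t * D)) (extr G p (t * D)) (r := t * D) (by positivity)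
    (by nlinarith) (by
      intro z hz w hw
      rw [mem_ext] at hz ⊢
      rw [mem_gball] at hw
      have := S.tri p w z
      rw [dsymm w z] at this
      linarith)
  have e1 : 2 * D / (t * D) = 2 / t := by field_simp
  rw [← hDd, e1, Real.mul_rpow ht.le hD0.le] at h
  have htθ : 0 < t ^ θ := Real.rpow_pos_of_pos ht θ
  have hDθ : 0 < D ^ θ := Real.rpow_pos_of_pos hD0 θ
  refine h.trans ?_
  calc CD ^ 5 * (CP * (t ^ θ * D ^ θ) * en K pi f (extr G p (t * D)) +
        (2 / t) ^ m * (∑ z, |f z| * pi z) ^ 2)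
      ≤ CD ^ 5 * (CP * (t ^ θ * D ^ θ) * (E0 * D ^ θ) + (2 / t) ^ m * (CL * D ^ θ) ^ 2) := by
        gcongr
    _ = _ := by ring

lemma final_far (S : Sett G K pi θ CD CP Cc m) (hD : (1 : ℝ) ≤ gdiam G) (x y : V)
    (c1 E0 CL : ℝ) (hc : 0 < c1) (hc1 : c1 ≤ 1) (hE0 : 0 ≤ E0) (hCL : 0 ≤ CL)
    (hρ : 1 ≤ c1 / 16 * gdiam G) (hd : c1 * gdiam G ≤ (G.dist x y : ℝ))
    (hE : ∀ p, en K pi (fun z => green K pi z p) (extr G p (5 * c1 / 32 * gdiam G)) ≤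
      E0 * (gdiam G : ℝ) ^ θ)
    (hL : ∀ p, ∑ z, |green K pi z p| * pi z ≤ CL * (gdiam G : ℝ) ^ θ) :
    |green K pi x y| ≤ (2 * CL + (Cc * CD ^ 5 * (E0 + (c1 / 16) ^ (-θ) *
      (CD ^ 5 * (CP * (5 * c1 / 32) ^ θ * E0 + (2 / (5 * c1 / 32)) ^ m * CL ^ 2))) + E0) / 2) *
        (gdiam G : ℝ) ^ θ := by
  have hCD := S.hCD
  have hCP := S.hCP
  have hCc := S.hCc
  set M0 := CD ^ 5 * (CP * (5 * c1 / 32) ^ θ * E0 + (2 / (5 * c1 / 32)) ^ m * CL ^ 2) with hM0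
  set D : ℝ := (gdiam G : ℝ) with hDd
  have hD0 : 0 < D := by linarith
  have hDθ : 0 < D ^ θ := Real.rpow_pos_of_pos hD0 θ
  have hM : ∀ p, mass pi (fun z => green K pi z p) (extr G p (2 * (5 * c1 / 32) * D)) ≤
      M0 * (D ^ θ) ^ 2 := fun p => S.far_mass hD p _ (5 * c1 / 32) E0 CL (by positivity)
        (by linarith) (hE p) (hL p)
  set ρ := c1 / 16 * D with hρd
  obtain ⟨φ, p0, p1, pR, pz, pA, pX⟩ := S.exists_cutoff y (8 * ρ) ρ hρ
  set A := ann G y (8 * ρ - 2 * ρ) (8 * ρ + 3 * ρ) with hA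
  have hdxy : 16 * ρ ≤ (G.dist y x : ℝ) := by rw [dsymm y x, hρd]; linarith
  have hAy : A ⊆ extr G y (2 * (5 * c1 / 32) * D) := by
    intro z hz
    rw [hA, mem_ann] at hz
    rw [mem_ext]
    rw [hρd] at hz
    linarith [hz.1]
  have hAx : A ⊆ extr G x (2 * (5 * c1 / 32) * D) := by
    intro z hz
    rw [hA, mem_ann] at hz
    rw [mem_ext]
    have := S.tri y z x
    rw [dsymm z x] at this
    have h2 := hz.2
    rw [hρd] at h2 hdxy
    linarith
  have hsub : ∀ p, extr G p (2 * (5 * c1 / 32) * D) ⊆ extr G p (5 * c1 / 32 * D) := by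
    intro p z hz
    rw [mem_ext] at *
    have : 0 ≤ c1 * D := by positivity
    linarith
  have hXb : ∀ p, A ⊆ extr G p (2 * (5 * c1 / 32) * D) →
      ∑ z, ∑ w, green K pi z p ^ 2 * (φ z - φ w) ^ 2 * JJ K pi z w +
        en K pi (fun z => green K pi z p) A ≤
      (Cc * CD ^ 5 * (E0 + (c1 / 16) ^ (-θ) * M0) + E0) * D ^ θ := by
    intro p hp
    have h1 := pX (fun z => green K pi z p)
    have h2 : en K pi (fun z => green K pi z p) A ≤ E0 * D ^ θ :=
      (en_mono S.jnn _ (hp.trans (hsub p))).trans (hE p)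
    have h3 : mass pi (fun z => green K pi z p) A ≤ M0 * (D ^ θ) ^ 2 :=
      (mass_mono S.pipos _ hp).trans (hM p)
    have h4 : ρ ^ (-θ) = (c1 / 16) ^ (-θ) * (D ^ θ)⁻¹ := by
      rw [hρd, Real.mul_rpow (by positivity) hD0.le, Real.rpow_neg hD0.le]
    have h5 : 0 ≤ (c1 / 16) ^ (-θ) := Real.rpow_nonneg (by positivity) _
    rw [h4] at h1
    have h6 : Cc * CD ^ 5 * (en K pi (fun z => green K pi z p) A + (c1 / 16) ^ (-θ) * (D ^ θ)⁻¹ *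
        mass pi (fun z => green K pi z p) A) ≤
        Cc * CD ^ 5 * (E0 * D ^ θ + (c1 / 16) ^ (-θ) * (D ^ θ)⁻¹ * (M0 * (D ^ θ) ^ 2)) := by
      gcongr
    have h7 : Cc * CD ^ 5 * (E0 * D ^ θ + (c1 / 16) ^ (-θ) * (D ^ θ)⁻¹ * (M0 * (D ^ θ) ^ 2)) =
        Cc * CD ^ 5 * (E0 + (c1 / 16) ^ (-θ) * M0) * D ^ θ := by
      field_simp
    linarith
  have hb := S.cross_bound (fun z => green K pi z y) (fun z => green K pi z x) φ A pA
  rw [S.green_id] at hb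
  have hu := hXb y hAy
  have hv := hXb x hAx
  have hφx : φ x = 1 := pR x (by linarith)
  have hφy : φ y = 0 := pz y (by simp; linarith)
  have hi : ∀ f : V → ℝ, ∀ p, ∑ z, φ z * f z *
      (green K pi z p - ∑ w, K z w * green K pi w p) * pi z =
      φ p * f p - ∑ z, φ z * f z * pi z := by
    intro f p
    have e : ∑ z, φ z * f z * (if z = p then 1 / pi p else 0) * pi z = φ p * f p := by
      rw [Finset.sum_eq_single p (fun b _ hb => by simp [hb]) (by simp)]
      have := (S.pipos p).ne'
      simp
      field_simp
    rw [← e, ← Finset.sum_sub_distrib]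
    refine Finset.sum_congr rfl fun z _ => ?_
    rw [S.green_eq hD p z]; ring
  have hφL : ∀ p, |∑ z, φ z * green K pi z p * pi z| ≤ CL * D ^ θ := by
    intro p
    refine (Finset.abs_sum_le_sum_abs _ _).trans (le_trans ?_ (hL p))
    refine Finset.sum_le_sum fun z _ => ?_
    rw [abs_mul, abs_mul, abs_of_nonneg (S.pipos z).le, abs_of_nonneg (p0 z)]
    refine mul_le_mul_of_nonneg_right ?_ (S.pipos z).le
    exact mul_le_of_le_one_left (abs_nonneg _) (p1 z)
  rw [hi (fun z => green K pi z y) x, hi (fun z => green K pi z x) y, hφx, hφy] at hb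
  simp only [one_mul, zero_mul] at hb
  have h1 := abs_le.1 (hφL x)
  have h2 := abs_le.1 (hφL y)
  have h3 := abs_le.1 hb
  rw [abs_le]
  constructor <;> linarith

lemma final_near (S : Sett G K pi θ CD CP Cc m) (hD : (1 : ℝ) ≤ gdiam G) (x y : V)
    (c1 CL : ℝ) (hc : 0 < c1) (hρ : c1 / 16 * gdiam G < 1)
    (hL : ∑ z, |green K pi z y| * pi z ≤ CL * (gdiam G : ℝ) ^ θ) :
    |green K pi x y| ≤ (CL * (4 * (16 / c1)) ^ m) * (gdiam G : ℝ) ^ θ := by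
  have h1 : |green K pi x y| * pi x ≤ CL * (gdiam G : ℝ) ^ θ :=
    (Finset.single_le_sum (f := fun z => |green K pi z y| * pi z)
      (fun z _ => mul_nonneg (abs_nonneg _) (S.pipos z).le) (Finset.mem_univ x)).trans hL
  have hp := S.pipos x
  have h2 := S.pi_lower x hD
  have h3 : (gdiam G : ℝ) ≤ 16 / c1 := by
    rw [le_div_iff₀ hc]; linarith
  have h4 : 1 / pi x ≤ (4 * (16 / c1)) ^ m := h2.trans (by gcongr)
  have h0 : 0 ≤ CL * (gdiam G : ℝ) ^ θ := (mul_nonneg (abs_nonneg _) hp.le).trans h1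
  calc |green K pi x y| = |green K pi x y| * pi x * (1 / pi x) := by field_simp
    _ ≤ CL * (gdiam G : ℝ) ^ θ * (4 * (16 / c1)) ^ m := by
        exact mul_le_mul h1 h4 (by positivity) h0
    _ = _ := by ring

end Sett

lemma main_sett (θ CD CP Cc c0 : ℝ) (m : ℕ) (hθ : 2 ≤ θ) (hCD : 1 ≤ CD) (hCP : 0 < CP)
    (hCc : 0 < Cc) (hc0 : 0 < c0) :
    ∃ C1 : ℝ, 0 < C1 ∧ ∀ (V : Type) [Fintype V] [DecidableEq V]
      (G : SimpleGraph V) (K : V → V → ℝ) (pi : V → ℝ),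
      Sett G K pi θ CD CP Cc m → ∀ x y : V, c0 * (gdiam G : ℝ) ≤ (G.dist x y : ℝ) →
            |green K pi x y| ≤ C1 * (gdiam G : ℝ) ^ θ := by
  set CL := (2 * (2 * (2 * CD ^ 5 * CP) * m / θ + 1) +
        4 * CP * (2 * (CD ^ 5 * 2 ^ m))) with hCL
  have hCD0 : 0 < CD := by linarith
  have hCL0 : 0 < CL := by rw [hCL]; positivity
  obtain ⟨X, hX, HX⟩ := energy_bound θ CD CP Cc CL m hθ hCD hCP hCc hCL0
  set c1 := min c0 1 with hc1d
  have hc : 0 < c1 := lt_min hc0 one_pos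
  have hc1 : c1 ≤ 1 := min_le_right _ _
  have hcc : c1 ≤ c0 := min_le_left _ _
  set t := 5 * c1 / 32 with ht
  have ht0 : 0 < t := by positivity
  have htθ : 0 < t ^ θ := Real.rpow_pos_of_pos ht0 θ
  set E0 := X / (t ^ θ * t ^ m) with hE0
  have hE00 : 0 < E0 := by positivity
  set F1 := (2 * CL + (Cc * CD ^ 5 * (E0 + (c1 / 16) ^ (-θ) *
      (CD ^ 5 * (CP * t ^ θ * E0 + (2 / t) ^ m * CL ^ 2))) + E0) / 2) with hF1
  set F2 := (CL * (4 * (16 / c1)) ^ m) with hF2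
  have hF20 : 0 < F2 := by positivity
  have hF10 : 0 < F1 := by
    have : 0 < (c1 / 16) ^ (-θ) := Real.rpow_pos_of_pos (by positivity) _
    positivity
  refine ⟨F1 + F2, by positivity, ?_⟩
  intro V _ _ G K pi S x y hd
  have hDθ : 0 ≤ (gdiam G : ℝ) ^ θ := Real.rpow_nonneg (Nat.cast_nonneg _) θ
  rcases Nat.eq_zero_or_pos (gdiam G) with h0 | h0
  · rw [S.green_zero h0, abs_zero]
    positivity
  have hD : (1 : ℝ) ≤ gdiam G := by exact_mod_cast h0
  have hL : ∀ p, ∑ z, |green K pi z p| * pi z ≤ CL * (gdiam G : ℝ) ^ θ := S.green_l1 hD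
  rcases lt_or_ge (c1 / 16 * (gdiam G : ℝ)) 1 with h | h
  · refine (S.final_near hD x y c1 CL hc h (hL y)).trans ?_
    gcongr
    linarith
  · have hE : ∀ p, en K pi (fun z => green K pi z p) (extr G p (t * gdiam G)) ≤
        E0 * (gdiam G : ℝ) ^ θ := by
      intro p
      have hD0 : (0 : ℝ) < gdiam G := by linarith
      have h1 := HX V G K pi S hD p (fun z => green K pi z p) (fun z hz => by
        rw [S.green_eq hD p z, if_neg hz]; ring) (hL p) (t * gdiam G) (by positivity)
        (by nlinarith)
      rw [Real.mul_rpow ht0.le hD0.le] at h1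
      set e := en K pi (fun z => green K pi z p) (extr G p (t * gdiam G))
      have hDθ' : 0 < (gdiam G : ℝ) ^ θ := Real.rpow_pos_of_pos hD0 θ
      have hDm : 0 < (gdiam G : ℝ) ^ m := by positivity
      have h2 : ((gdiam G : ℝ) ^ m * (gdiam G : ℝ) ^ θ) * (e * (t ^ θ * t ^ m)) ≤
          ((gdiam G : ℝ) ^ m * (gdiam G : ℝ) ^ θ) * (X * (gdiam G : ℝ) ^ θ) := by
        rw [mul_pow] at h1
        linarith
      have h3 := le_of_mul_le_mul_left h2 (by positivity)
      rw [hE0, div_mul_eq_mul_div, le_div_iff₀ (by positivity)]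
      exact h3
    refine (S.final_far hD x y c1 E0 CL hc hc1 hE00.le hCL0.le h ?_ hE hL).trans ?_
    · refine le_trans ?_ hd
      gcongr
    · rw [← ht, ← hF1]
      gcongr
      linarith

lemma en_ite (K : V → V → ℝ) (pi f : V → ℝ) (A : Finset V) : en K pi f A =
    ∑ z, ∑ w, (if z ∈ A ∧ w ∈ A then (f z - f w) ^ 2 * JJ K pi z w else 0) := by
  unfold en
  rw [← Finset.sum_filter_add_sum_filter_not univ (fun z => z ∈ A)]
  rw [Finset.sum_eq_zero (s := univ.filter fun z => ¬ z ∈ A), add_zero]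
  · rw [Finset.filter_mem_eq_inter, Finset.univ_inter]
    refine Finset.sum_congr rfl fun z hz => ?_
    simp only [hz, true_and]
    rw [← Finset.sum_filter, Finset.filter_mem_eq_inter, Finset.univ_inter]
  · intro z hz
    rw [Finset.mem_filter] at hz
    exact Finset.sum_eq_zero fun w _ => by simp [hz.2]

lemma adj_ite {G : SimpleGraph V} {K : V → V → ℝ} {pi : V → ℝ} (h : IsMarkovKernel G K pi)
    (f : V → ℝ) (z w : V) :
    (if G.Adj z w then (f z - f w) ^ 2 * K z w * pi z else 0) = (f z - f w) ^ 2 * JJ K pi z w := by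
  obtain ⟨_, _, _, _, _, _, _, hK, _⟩ := h
  unfold JJ
  split_ifs with ha
  · ring
  · by_cases hzw : z = w
    · subst hzw; simp
    · rw [hK z w hzw ha]; simp

lemma clip_sq (a b : ℝ) : (min (max a 0) 1 - min (max b 0) 1) ^ 2 ≤ (a - b) ^ 2 := by
  rw [sq_le_sq]
  refine (abs_min_sub_min_le_max _ _ _ _).trans ?_
  simp only [sub_self, abs_zero]
  refine max_le ?_ (abs_nonneg _)
  refine (abs_max_sub_max_le_max _ _ _ _).trans ?_
  simp

lemma cs_of {G : SimpleGraph V} {K : V → V → ℝ} {pi : V → ℝ} {θ C1 C2 ε : ℝ}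
    (h : IsMarkovKernel G K pi) (hC2 : 0 < C2) (hcs : CondCS G K pi θ C1 C2 ε) (x : V) (r : ℝ)
    (hr : 1 ≤ r) : ∃ σ : V → ℝ,
    (∀ z, 0 ≤ σ z) ∧ (∀ z, σ z ≤ 1) ∧
    (∀ z, (G.dist x z : ℝ) ≤ r / 2 → σ z = 1) ∧
    (∀ z, r < (G.dist x z : ℝ) → σ z = 0) ∧
    (∀ f : V → ℝ, ∑ z, ∑ w, f z ^ 2 * (σ z - σ w) ^ 2 * JJ K pi z w ≤
      (3 * |C2| + 2) *
        (en K pi f (gball G x (2 * r)) + r ^ (-θ) * mass pi f (gball G x (2 * r)))) := by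
  obtain ⟨σ, ha, hb, _, hd⟩ := hcs x r (by linarith)
  refine ⟨fun z => min (max (σ z) 0) 1, fun z => le_min (le_max_right _ _) zero_le_one,
    fun z => min_le_right _ _, ?_, ?_, ?_⟩
  · intro z hz
    have := ha z ((mem_gball _ _ _ _).2 hz)
    exact min_eq_right (le_max_of_le_left this)
  · intro z hz
    have := hb z (by rw [mem_gball]; linarith)
    simp [this]
  intro f
  have hd' := hd r (by linarith) le_rfl f
  rw [div_self (by linarith), Real.one_rpow, mul_one] at hd'
  simp only [sq_abs, adj_ite h] at hd'
  change _ ≤ C2 * (en K pi f (gball G x (2 * r)) + r ^ (-θ) * mass pi f (gball G x (2 * r))) at hd'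
  have hJn : ∀ z w, 0 ≤ JJ K pi z w := fun z w => mul_nonneg (h.2.2.2.1 z).le (h.2.1 z w)
  have hJs : ∀ z w, JJ K pi z w = JJ K pi w z := fun z w => h.2.2.2.2.2.1 z w
  have hM0 : 0 ≤ r ^ (-θ) * mass pi f (gball G x (2 * r)) :=
    mul_nonneg (Real.rpow_nonneg (by linarith) _) (mass_nonneg h.2.2.2.1 _ _)
  set Q := ∑ z ∈ gball G x r, f z ^ 2 * ∑ y, (σ z - σ y) ^ 2 * JJ K pi z y with hQ
  have hQ1 : Q = ∑ z, ∑ w, (if z ∈ gball G x r then f z ^ 2 * ((σ z - σ w) ^ 2 * JJ K pi z w)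
      else 0) := by
    rw [hQ, ← Finset.univ_inter (gball G x r), ← Finset.filter_mem_eq_inter, Finset.sum_filter]
    refine Finset.sum_congr rfl fun z _ => ?_
    simp only [Finset.univ_inter, Finset.filter_mem_eq_inter]
    split_ifs with hz
    · rw [Finset.mul_sum]
    · simp
  have hQ2 : Q = ∑ z, ∑ w, (if w ∈ gball G x r then f w ^ 2 * ((σ w - σ z) ^ 2 * JJ K pi w z)
      else 0) := by
    rw [hQ1, Finset.sum_comm]
  have hpt : ∀ z w, f z ^ 2 * (min (max (σ z) 0) 1 - min (max (σ w) 0) 1) ^ 2 * JJ K pi z w ≤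
      (if z ∈ gball G x r then f z ^ 2 * ((σ z - σ w) ^ 2 * JJ K pi z w) else 0) +
      2 * (if w ∈ gball G x r then f w ^ 2 * ((σ w - σ z) ^ 2 * JJ K pi w z) else 0) +
      2 * (if z ∈ gball G x (2 * r) ∧ w ∈ gball G x (2 * r) then
        (f z - f w) ^ 2 * JJ K pi z w else 0) := by
    intro z w
    have hJ := hJn z w
    have hJ' := hJn w z
    have hcl := clip_sq (σ z) (σ w)
    have n2 : 0 ≤ (if w ∈ gball G x r then f w ^ 2 * ((σ w - σ z) ^ 2 * JJ K pi w z) else 0) := by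
      split_ifs <;> positivity
    have n3 : 0 ≤ (if z ∈ gball G x (2 * r) ∧ w ∈ gball G x (2 * r) then
        (f z - f w) ^ 2 * JJ K pi z w else 0) := by
      split_ifs <;> positivity
    by_cases hz : z ∈ gball G x r
    · rw [if_pos hz]
      have : f z ^ 2 * (min (max (σ z) 0) 1 - min (max (σ w) 0) 1) ^ 2 * JJ K pi z w ≤
          f z ^ 2 * (σ z - σ w) ^ 2 * JJ K pi z w := by gcongr
      linarith
    · rw [if_neg hz]
      by_cases hw : w ∈ gball G x r
      · by_cases hJ0 : JJ K pi z w = 0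
        · rw [hJ0, mul_zero]
          rw [hJ0] at n3
          linarith
        have hz2 : z ∈ gball G x (2 * r) := by
          rw [mem_gball] at hw ⊢
          have hle : G.dist w z ≤ 1 := by
            by_cases hzw : z = w
            · subst hzw; simp
            · by_cases hadj : G.Adj w z
              · exact (SimpleGraph.dist_eq_one_iff_adj.2 hadj).le
              · exfalso
                apply hJ0
                unfold JJ
                rw [h.2.2.2.2.2.2.2.1 z w hzw (fun hh => hadj hh.symm), mul_zero]
          have h1 : (G.dist w z : ℝ) ≤ 1 := by exact_mod_cast hle
          have h2 : (G.dist x z : ℝ) ≤ G.dist x w + G.dist w z := by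
            exact_mod_cast h.1.dist_triangle
          linarith
        have hw2 : w ∈ gball G x (2 * r) := by
          rw [mem_gball] at hw ⊢; linarith
        rw [if_pos hw, if_pos ⟨hz2, hw2⟩, hJs w z]
        set d := (min (max (σ z) 0) 1 - min (max (σ w) 0) 1) ^ 2 with hdd
        have hd0 : 0 ≤ d := sq_nonneg _
        have hd1 : d ≤ 1 := by
          have a1 : 0 ≤ min (max (σ z) 0) 1 := le_min (le_max_right _ _) zero_le_one
          have a2 : min (max (σ z) 0) 1 ≤ 1 := min_le_right _ _
          have b1 : 0 ≤ min (max (σ w) 0) 1 := le_min (le_max_right _ _) zero_le_one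
          have b2 : min (max (σ w) 0) 1 ≤ 1 := min_le_right _ _
          rw [hdd, sq_le_one_iff_abs_le_one, abs_le]
          constructor <;> linarith
        have e1 : f z ^ 2 ≤ 2 * f w ^ 2 + 2 * (f z - f w) ^ 2 := by
          nlinarith [sq_nonneg (f z - 2 * f w)]
        have e2 : f z ^ 2 * d ≤ 2 * (f w ^ 2 * (σ w - σ z) ^ 2) + 2 * (f z - f w) ^ 2 := by
          have e3 : f w ^ 2 * d ≤ f w ^ 2 * (σ z - σ w) ^ 2 :=
            mul_le_mul_of_nonneg_left hcl (sq_nonneg _)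
          have e4 : (f z - f w) ^ 2 * d ≤ (f z - f w) ^ 2 :=
            mul_le_of_le_one_right (sq_nonneg _) hd1
          have e5 := mul_le_mul_of_nonneg_right e1 hd0
          have e6 : (σ w - σ z) ^ 2 = (σ z - σ w) ^ 2 := by ring
          rw [e6]
          linarith
        have e7 := mul_le_mul_of_nonneg_right e2 hJ
        linarith
      · have : f z ^ 2 * (min (max (σ z) 0) 1 - min (max (σ w) 0) 1) ^ 2 * JJ K pi z w = 0 := by
          rw [hb z hz, hb w hw]; simp
        rw [this]
        linarith
  have hsum : ∑ z, ∑ w, f z ^ 2 * (min (max (σ z) 0) 1 - min (max (σ w) 0) 1) ^ 2 * JJ K pi z w ≤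
      Q + 2 * Q + 2 * en K pi f (gball G x (2 * r)) := by
    nth_rewrite 1 [hQ1]
    rw [hQ2, en_ite]
    simp only [Finset.mul_sum, ← Finset.sum_add_distrib]
    exact Finset.sum_le_sum fun z _ => Finset.sum_le_sum fun w _ => hpt z w
  rw [abs_of_pos hC2]
  refine hsum.trans ?_
  nlinarith

lemma pI_of {G : SimpleGraph V} {K : V → V → ℝ} {pi : V → ℝ} {θ CP : ℝ}
    (h : IsMarkovKernel G K pi) (hpi : CondPI G K pi θ CP) (x : V) (r : ℝ) (hr : 0 < r)
    (f : V → ℝ) : mass pi f (gball G x r) ≤ max CP 1 * r ^ θ * en K pi f (gball G x r) +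
      (∑ z ∈ gball G x r, f z * pi z) ^ 2 / vol G pi x r := by
  have h1 := hpi x r hr f
  simp only [sq_abs, adj_ite h] at h1
  change _ ≤ CP * r ^ θ * en K pi f (gball G x r) at h1
  have hv : 0 < vol G pi x r := by
    unfold vol
    refine Finset.sum_pos (fun z _ => h.2.2.2.1 z) ⟨x, ?_⟩
    rw [mem_gball]; simpa using hr.le
  have hJn : ∀ z w, 0 ≤ JJ K pi z w := fun z w => mul_nonneg (h.2.2.2.1 z).le (h.2.1 z w)
  have he := en_nonneg hJn f (gball G x r)
  have hrθ : 0 ≤ r ^ θ := Real.rpow_nonneg hr.le _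
  have h2 : CP * r ^ θ * en K pi f (gball G x r) ≤ max CP 1 * r ^ θ * en K pi f (gball G x r) := by
    gcongr
    exact le_max_left _ _
  set a := ballAvg G pi x r f with ha
  set M := ∑ z ∈ gball G x r, f z * pi z with hM
  have h3 : ∑ z ∈ gball G x r, (f z - a) ^ 2 * pi z =
      mass pi f (gball G x r) - 2 * a * M + a ^ 2 * vol G pi x r := by
    unfold mass vol
    rw [hM, Finset.mul_sum, Finset.mul_sum, ← Finset.sum_sub_distrib, ← Finset.sum_add_distrib]
    exact Finset.sum_congr rfl fun z _ => by ring
  have h4 : a = (vol G pi x r)⁻¹ * M := rfl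
  have h5 : 2 * a * M - a ^ 2 * vol G pi x r = M ^ 2 / vol G pi x r := by
    rw [h4]
    field_simp
    ring
  linarith

lemma sett_of {G : SimpleGraph V} {K : V → V → ℝ} {pi : V → ℝ} {θ p0 CD CP Ccs1 Ccs2 ε : ℝ}
    {m : ℕ} (hθ : 2 ≤ θ) (hm : 1 ≤ m) (hCDm : max CD 1 ≤ 2 ^ m)
    (h : IsMarkovKernel G K pi) (hH : Harnack G K pi θ p0 CD CP Ccs1 Ccs2 ε) (hl : Lazy K) :
    Sett G K pi θ (max CD 1) (max CP 1) (3 * |Ccs2| + 2) m := by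
  obtain ⟨_, _, _, _, hC2, _, _, hvd, hpi, hcs⟩ := hH
  have h' := h
  obtain ⟨k1, k2, k3, k4, k5, k6, k7, k8, k9⟩ := h'
  refine ⟨k1, k2, k3, k4, k5, k6, ?_, hl, hθ, le_max_right _ _, by positivity, by positivity, hm,
    hCDm, ?_, pI_of h hpi, cs_of h hC2 hcs⟩
  · intro x y hxy
    by_cases hne : x = y
    · subst hne; simp
    · by_cases hadj : G.Adj x y
      · rw [SimpleGraph.dist_eq_one_iff_adj.2 hadj]; simp
      · exact absurd (k8 x y hne hadj) hxy
  · intro x r hr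
    refine (hvd x r hr).trans ?_
    refine mul_le_mul_of_nonneg_right (le_max_left _ _) ?_
    exact Finset.sum_nonneg fun z _ => (k4 z).le

/-- For a lazy Harnack graph and `x,y` with `d(x,y) ≥ c₀ D`,
the normalized Green function satisfies `|𝒢(x,y)| ≤ C₁ D^θ`. -/
theorem stmt7 (θ p0 CD CP Ccs1 Ccs2 ε : ℝ) (hθ : 2 ≤ θ) (c0 : ℝ) (hc0 : 0 < c0) :
    ∃ C1 > (0 : ℝ),
      ∀ (V : Type) [Fintype V] [DecidableEq V],
        ∀ (G : SimpleGraph V) (K : V → V → ℝ) (pi : V → ℝ),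
          IsMarkovKernel G K pi → Harnack G K pi θ p0 CD CP Ccs1 Ccs2 ε → Lazy K →
          ∀ x y : V, c0 * (gdiam G : ℝ) ≤ (G.dist x y : ℝ) →
            |green K pi x y| ≤ C1 * (gdiam G : ℝ) ^ θ := by
  obtain ⟨m, hm⟩ := pow_unbounded_of_one_lt (max CD 1) (by norm_num : (1 : ℝ) < 2)
  obtain ⟨C1, hC1, H⟩ := main_sett θ (max CD 1) (max CP 1) (3 * |Ccs2| + 2) c0 (m + 1) hθ
    (le_max_right _ _) (by positivity) (by positivity) hc0
  refine ⟨C1, hC1, ?_⟩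
  intro V _ _ G K pi hK hH hl x y hd
  refine H V G K pi (sett_of hθ (by omega) ?_ hK hH hl) x y hd
  refine hm.le.trans ?_
  exact pow_le_pow_right₀ (by norm_num) (by omega)
end

section
/- Let (Γ,K,π) be any Markov kernel, let o ∈ V, and let (X_n)_{n≥0} be the Markov chain driven by K with X_0 = o. Then for all real R > 0 and every integer t ≥ 0, P_o( max_{0 < s ≤ t} d(o, X_s) > R ) ≤ 2 · sup_{0 ≤ s ≤ t} ( sup_{x ∈ B(o, R+1)} P_x( d(x, X_s) > R/2 ) ), where P_x denotes the law of the chain driven by K started at x, and the outer suprema are over integer times s. -/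
open Finset
open scoped Classical

variable {V : Type*} [Fintype V] [DecidableEq V]

/-- `P_x(d(o, X_s) > R)`. -/
noncomputable def probGtFrom (G : SimpleGraph V) (K : V → V → ℝ) (o x : V) (s : ℕ) (R : ℝ) : ℝ :=
  ∑ y ∈ univ.filter (fun y => R < (G.dist o y : ℝ)), matpow K s x y

section Helpers

theorem aux_pathProb_succ (K : V → V → ℝ) (x : V) (t : ℕ) (A : (Fin (t + 2) → V) → Prop) :
    pathProb K x (t + 1) A =
      ∑ z, K x z * pathProb K z t (fun p => A (Fin.cons x p)) := by
  unfold pathProb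
  simp only [Finset.sum_filter, Finset.mul_sum]
  rw [Finset.sum_comm]
  rw [← (Fin.consEquiv (fun _ : Fin (t + 2) => V)).sum_comp, Fintype.sum_prod_type]
  rw [Finset.sum_eq_single x]
  · refine Finset.sum_congr rfl fun p _ => ?_
    rw [Finset.sum_eq_single (p 0)]
    · by_cases hA : A (Fin.cons x p)
      · simp [Fin.consEquiv, hA, Fin.prod_univ_succ (n := t)]
      · simp [Fin.consEquiv, hA]
    · intro z _ hz
      simp [Ne.symm hz]
    · simp
  · intro z _ hz
    simp [Fin.consEquiv, hz]
  · simp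

theorem aux_pathProb_zero (K : V → V → ℝ) (x : V) (A : (Fin 1 → V) → Prop) :
    pathProb K x 0 A = if A (fun _ => x) then 1 else 0 := by
  unfold pathProb
  rw [Finset.sum_filter, Finset.sum_eq_single (fun _ => x)]
  · simp
  · intro p _ hp
    have : p 0 ≠ x := by
      intro h
      apply hp
      funext i
      have hi : i = 0 := Fin.ext (by have := i.isLt; simp)
      rw [hi, h]
    simp [this]
  · simp

theorem aux_pathProb_le_one (K : V → V → ℝ) (h0 : ∀ x y, 0 ≤ K x y) (h1 : ∀ x, ∑ y, K x y = 1)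
    (t : ℕ) : ∀ (x : V) (A : (Fin (t + 1) → V) → Prop), pathProb K x t A ≤ 1 := by
  induction t with
  | zero =>
    intro x A
    rw [aux_pathProb_zero]
    split_ifs <;> norm_num
  | succ n ih =>
    intro x A
    rw [aux_pathProb_succ, ← h1 x]
    refine Finset.sum_le_sum fun z _ => ?_
    exact mul_le_of_le_one_right (h0 x z) (ih z _)

theorem aux_matpow_nonneg (K : V → V → ℝ) (h0 : ∀ x y, 0 ≤ K x y) (n : ℕ) :
    ∀ x y, 0 ≤ matpow K n x y := by
  induction n with
  | zero => intro x y; simp only [matpow]; split_ifs <;> norm_num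
  | succ n ih =>
    intro x y
    exact Finset.sum_nonneg fun z _ => mul_nonneg (h0 x z) (ih z y)

theorem aux_matpow_succ_sum (K : V → V → ℝ) (n : ℕ) (x : V) (S : Finset V) :
    ∑ y ∈ S, matpow K (n + 1) x y = ∑ z, K x z * ∑ y ∈ S, matpow K n z y := by
  simp only [matpow, Finset.mul_sum]
  rw [Finset.sum_comm]

theorem aux_matpow_sum (K : V → V → ℝ) (h1 : ∀ x, ∑ y, K x y = 1) (n : ℕ) :
    ∀ x, ∑ y, matpow K n x y = 1 := by
  induction n with
  | zero => intro x; simp [matpow]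
  | succ n ih =>
    intro x
    rw [aux_matpow_succ_sum]
    simp [ih, h1]

theorem aux_main (G : SimpleGraph V) (K : V → V → ℝ) (hG : G.Connected)
    (h0 : ∀ x y, 0 ≤ K x y) (h1 : ∀ x, ∑ y, K x y = 1)
    (hK : ∀ x y, x ≠ y → ¬ G.Adj x y → K x y = 0) (o : V) (R : ℝ) (C : ℝ) (hC0 : 0 ≤ C)
    (t : ℕ)
    (hC : ∀ s : ℕ, s ≤ t → ∀ x ∈ gball G o (R + 1), probGt G K x s (R / 2) ≤ C) :
    ∀ n ≤ t, ∀ x, (G.dist o x : ℝ) ≤ R + 1 →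
      pathProb K x n (fun p => ∃ s : Fin (n + 1), R < (G.dist o (p s) : ℝ)) ≤
        probGtFrom G K o x n (R / 2) + C := by
  have hnn : ∀ n x, 0 ≤ probGtFrom G K o x n (R / 2) := fun n x =>
    Finset.sum_nonneg fun y _ => aux_matpow_nonneg K h0 n x y
  have far : ∀ n ≤ t, ∀ x, (G.dist o x : ℝ) ≤ R + 1 → R < (G.dist o x : ℝ) →
      pathProb K x n (fun p => ∃ s : Fin (n + 1), R < (G.dist o (p s) : ℝ)) ≤
        probGtFrom G K o x n (R / 2) + C := by
    intro n hn x hx hxR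
    refine (aux_pathProb_le_one K h0 h1 n x _).trans ?_
    have h2 := hC n hn x (by simpa [gball] using hx)
    rw [← aux_matpow_sum K h1 n x,
      ← Finset.sum_filter_add_sum_filter_not univ (fun y => R / 2 < (G.dist o y : ℝ))]
    refine add_le_add le_rfl (le_trans ?_ h2)
    refine Finset.sum_le_sum_of_subset_of_nonneg ?_ fun y _ _ => aux_matpow_nonneg K h0 n x y
    intro y hy
    simp only [Finset.mem_filter, Finset.mem_univ, true_and, not_lt] at hy ⊢
    have h3 : G.dist o x ≤ G.dist o y + G.dist y x := hG.dist_triangle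
    rw [G.dist_comm (u := y)] at h3
    have h4 : (G.dist o x : ℝ) ≤ G.dist o y + G.dist x y := by exact_mod_cast h3
    linarith
  intro n
  induction n with
  | zero =>
    intro hn x hx
    by_cases hxR : R < (G.dist o x : ℝ)
    · exact far 0 hn x hx hxR
    · rw [aux_pathProb_zero]
      rw [if_neg (by simpa using hxR)]
      have := hnn 0 x
      linarith
  | succ n ih =>
    intro hn x hx
    by_cases hxR : R < (G.dist o x : ℝ)
    · exact far (n + 1) hn x hx hxR
    · rw [aux_pathProb_succ]
      have e : probGtFrom G K o x (n + 1) (R / 2) + C =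
          ∑ z, K x z * (probGtFrom G K o z n (R / 2) + C) := by
        simp only [mul_add, Finset.sum_add_distrib, ← Finset.sum_mul, h1, one_mul]
        congr 1
        exact aux_matpow_succ_sum K n x _
      rw [e]
      refine Finset.sum_le_sum fun z _ => ?_
      by_cases hz : K x z = 0
      · simp [hz]
      · refine mul_le_mul_of_nonneg_left ?_ (h0 x z)
        have hd : G.dist x z ≤ 1 := by
          by_cases hxz : x = z
          · simp [hxz]
          · have hadj : G.Adj x z := by
              by_contra h
              exact hz (hK x z hxz h)
            exact (SimpleGraph.dist_eq_one_iff_adj.mpr hadj).le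
        have h3 : G.dist o z ≤ G.dist o x + G.dist x z := hG.dist_triangle
        have h4 : (G.dist o z : ℝ) ≤ G.dist o x + 1 := by exact_mod_cast h3.trans (by omega)
        have h5 := ih (by omega) z (by linarith)
        simpa [Fin.exists_fin_succ (n := n + 1), hxR] using h5

end Helpers

/-- Exit-time estimate: for every `R > 0` and integer `t ≥ 0`,
`P_o(max_{0 < s ≤ t} d(o,X_s) > R) ≤ 2 sup_{0 ≤ s ≤ t} sup_{x ∈ B(o,R+1)} P_x(d(x,X_s) > R/2)`,
formulated via upper bounds `C` of the inner family. -/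
theorem stmt9 (V : Type) [Fintype V] [DecidableEq V]
    (G : SimpleGraph V) (K : V → V → ℝ) (pi : V → ℝ)
    (hM : IsMarkovKernel G K pi) (o : V) (R : ℝ) (hR : 0 < R) (t : ℕ) :
    ∀ C : ℝ,
      (∀ s : ℕ, s ≤ t → ∀ x ∈ gball G o (R + 1), probGt G K x s (R / 2) ≤ C) →
      pathProb K o t
          (fun p => ∃ s : Fin (t + 1), 0 < (s : ℕ) ∧ R < (G.dist o (p s) : ℝ)) ≤
        2 * C := by
  intro C hC
  obtain ⟨hG, h0, h1, -, -, -, -, hK, -⟩ := hM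
  have ho : o ∈ gball G o (R + 1) := by
    simp only [gball, Finset.mem_filter, Finset.mem_univ, true_and, SimpleGraph.dist_self,
      Nat.cast_zero]
    linarith
  have hC0 : 0 ≤ C := le_trans
    (Finset.sum_nonneg fun y _ => aux_matpow_nonneg K h0 0 o y) (hC 0 (Nat.zero_le _) o ho)
  have h := aux_main G K hG h0 h1 hK o R C hC0 t hC t le_rfl o (by simp; linarith)
  have h2 : probGtFrom G K o o t (R / 2) ≤ C := hC t le_rfl o ho
  refine le_trans ?_ (h.trans (by linarith))
  refine Finset.sum_le_sum_of_subset_of_nonneg ?_ fun p _ _ =>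
    Finset.prod_nonneg fun i _ => h0 _ _
  intro p hp
  simp only [Finset.mem_filter, Finset.mem_univ, true_and] at hp ⊢
  obtain ⟨hp0, s, -, hs⟩ := hp
  exact ⟨hp0, s, hs⟩
end
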